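/- Let μ be a complex number and n a positive even integer. Then det_{1≤i,j≤n}( −δ_{i,j} + C(μ+i+j−2, j) ) = (−1)^{n/2} · 2^{n(n+2)/4} · (μ/2)_{n/2} / (n/2)! · ( ∏_{i=0}^{(n−2)/2} i!² / (2i)!² ) · ∏_{i=1}^{⌊n/4⌋} ( (½(μ+6i−1))_{(n−4i+2)/2} )² · ( (½(−μ−3n+6i))_{(n−4i)/2} )². -/

import Mathlib

/-- Generalized binomial coefficient `C(x,k) = x(x-1)⋯(x-k+1)/k!` for complex `x`. -/
noncomputable def gbinom (x : ℂ) (k : ℕ) : ℂ :=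
  (∏ i ∈ Finset.range k, (x - i)) / (k.factorial : ℂ)

/-- Pochhammer symbol `(x)_k = x(x+1)⋯(x+k-1)`. -/
noncomputable def poch (x : ℂ) (k : ℕ) : ℂ :=
  ∏ i ∈ Finset.range k, (x + i)

open PowerSeries in
/-- The power series `(1 + X) ^ e` for a complex exponent `e`. -/
noncomputable def binSeries (e : ℂ) : ℂ⟦X⟧ := PowerSeries.mk (gbinom e)

/-- The Euler operator `X d/dX`. -/
noncomputable def euler (f : PowerSeries ℂ) : PowerSeries ℂ :=
  PowerSeries.X * PowerSeries.derivative ℂ f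

section Basics

lemma gbinom_zero (x : ℂ) : gbinom x 0 = 1 := by simp [gbinom]

lemma gbinom_succ (x : ℂ) (k : ℕ) : gbinom x (k + 1) * (k + 1) = gbinom x k * (x - k) := by
  have h : (k.factorial : ℂ) ≠ 0 := by exact_mod_cast k.factorial_ne_zero
  have h' : (k : ℂ) + 1 ≠ 0 := by exact_mod_cast k.succ_ne_zero
  simp only [gbinom, Finset.prod_range_succ, Nat.factorial_succ]
  push_cast
  field_simp

lemma gbinom_pascal (x : ℂ) (k : ℕ) :
    gbinom (x + 1) (k + 1) = gbinom x k + gbinom x (k + 1) := by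
  induction k with
  | zero =>
    have h1 := gbinom_succ x 0
    have h2 := gbinom_succ (x + 1) 0
    simp only [gbinom_zero] at *
    push_cast at *
    linear_combination h2 - h1
  | succ k ih =>
    have h' : (k : ℂ) + 1 + 1 ≠ 0 := by exact_mod_cast (k + 1).succ_ne_zero
    have h1 := gbinom_succ x (k + 1)
    have h2 := gbinom_succ (x + 1) (k + 1)
    have h3 := gbinom_succ x k
    push_cast at *
    apply mul_right_cancel₀ h'
    linear_combination h2 - h1 + (x - k) * ih - h3

lemma gbinom_natCast (n k : ℕ) : gbinom n k = n.choose k := by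
  induction n generalizing k with
  | zero =>
    cases k with
    | zero => simp [gbinom_zero]
    | succ k => simp [gbinom, Finset.prod_range_succ']
  | succ n ih =>
    cases k with
    | zero => simp [gbinom_zero]
    | succ k =>
      push_cast
      rw [gbinom_pascal, ih, ih, Nat.choose_succ_succ]
      push_cast
      ring

lemma poch_zero (x : ℂ) : poch x 0 = 1 := by simp [poch]

lemma poch_succ (x : ℂ) (k : ℕ) : poch x (k + 1) = poch x k * (x + k) := by
  simp [poch, Finset.prod_range_succ]

lemma poch_add (x : ℂ) (k l : ℕ) : poch x (k + l) = poch x k * poch (x + k) l := by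
  simp [poch, Finset.prod_range_add, add_assoc]

lemma poch_ne_zero {x : ℂ} {k : ℕ} (h : ∀ i < k, x + i ≠ 0) : poch x k ≠ 0 :=
  Finset.prod_ne_zero_iff.2 fun i hi => h i (Finset.mem_range.1 hi)

lemma gbinom_neg (x : ℂ) (k : ℕ) : gbinom (-x) k = (-1) ^ k * (poch x k / k.factorial) := by
  have h : ∏ i ∈ Finset.range k, (-x - (i : ℂ)) = (-1) ^ k * poch x k := by
    induction k with
    | zero => simp [poch]
    | succ k ih =>
      rw [Finset.prod_range_succ, ih, poch_succ]
      ring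
  rw [gbinom, h, mul_div_assoc]

lemma coeff_euler (f : PowerSeries ℂ) (n : ℕ) :
    (euler f).coeff n = n * f.coeff n := by
  cases n with
  | zero => simp [euler]
  | succ n =>
    rw [euler, PowerSeries.coeff_succ_X_mul, PowerSeries.coeff_derivative]
    push_cast
    ring

lemma euler_mul (f g : PowerSeries ℂ) : euler (f * g) = euler f * g + f * euler g := by
  simp only [euler, Derivation.leibniz, smul_eq_mul]
  ring

lemma euler_add (f g : PowerSeries ℂ) : euler (f + g) = euler f + euler g := by
  simp only [euler, map_add]
  ring

lemma euler_neg (f : PowerSeries ℂ) : euler (-f) = -euler f := by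
  simp only [euler, map_neg]
  ring

lemma euler_C (c : ℂ) : euler (PowerSeries.C c) = 0 := by
  simp [euler, PowerSeries.derivative_C]

lemma euler_one : euler 1 = 0 := by simp [euler]

lemma euler_X : euler PowerSeries.X = PowerSeries.X := by simp [euler]

lemma euler_X_pow (k : ℕ) :
    euler (PowerSeries.X ^ k) = PowerSeries.C (k : ℂ) * PowerSeries.X ^ k := by
  induction k with
  | zero => simp [euler_one]
  | succ k ih =>
    rw [pow_succ, euler_mul, ih, euler_X]
    push_cast
    rw [map_add, map_one]
    ring

lemma binSeries_add_one (e : ℂ) : binSeries (e + 1) = (1 + PowerSeries.X) * binSeries e := by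
  ext n
  rw [add_mul, one_mul, map_add]
  cases n with
  | zero => simp [binSeries, gbinom_zero]
  | succ n =>
    rw [PowerSeries.coeff_succ_X_mul]
    simp only [binSeries, PowerSeries.coeff_mk]
    rw [gbinom_pascal, add_comm]

lemma euler_binSeries (e : ℂ) :
    (1 + PowerSeries.X) * euler (binSeries e)
      = PowerSeries.C e * PowerSeries.X * binSeries e := by
  ext n
  rw [add_mul, one_mul, map_add, mul_assoc, PowerSeries.coeff_C_mul]
  cases n with
  | zero => simp [coeff_euler]
  | succ n =>
    rw [PowerSeries.coeff_succ_X_mul, PowerSeries.coeff_succ_X_mul]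
    simp only [binSeries, PowerSeries.coeff_mk, coeff_euler]
    have := gbinom_succ e n
    push_cast
    linear_combination this

lemma binSeries_zero : binSeries 0 = 1 := by
  ext n
  have := gbinom_natCast 0 n
  rw [binSeries, PowerSeries.coeff_mk, PowerSeries.coeff_one]
  push_cast at this
  rw [this]
  cases n <;> simp

lemma binSeries_add_natCast (e : ℂ) (n : ℕ) :
    binSeries (e + n) = (1 + PowerSeries.X) ^ n * binSeries e := by
  induction n with
  | zero => simp
  | succ n ih =>
    push_cast
    rw [← add_assoc, binSeries_add_one, ih]
    ring

end Basics

section DifferentialEquation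

open PowerSeries

/-- `X` times the third order differential operator that annihilates the two expansions of the
kernel polynomial around `1`. -/
noncomputable def kernelOp (N a : ℂ) (f : ℂ⟦X⟧) : ℂ⟦X⟧ :=
  (1 + X) ^ 2 * (euler (euler (euler f)) - 3 * euler (euler f) + 2 * euler f)
    + C (2 + 2 * a) * (1 + X) * (1 + 2 * X) * (euler (euler f) - euler f)
    + (C (-2 * N * (1 + 2 * N + 2 * a))
      + C (2 + 6 * a + 4 * a ^ 2 - 4 * a * N - 4 * N ^ 2 - 2 * N) * (X + X ^ 2)) * euler f
    + C (-2 * N * a * (2 * a + 2 * N + 1)) * (X + 2 * X ^ 2) * f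

lemma kernelOp_add (N a : ℂ) (f g : ℂ⟦X⟧) :
    kernelOp N a (f + g) = kernelOp N a f + kernelOp N a g := by
  simp only [kernelOp, euler_add]
  ring

lemma kernelOp_C_mul (N a c : ℂ) (f : ℂ⟦X⟧) :
    kernelOp N a (C c * f) = C c * kernelOp N a f := by
  simp only [kernelOp, euler_mul, euler_C, zero_mul, zero_add]
  ring

lemma kernelOp_sum (N a : ℂ) (s : Finset ℕ) (f : ℕ → ℂ⟦X⟧) :
    kernelOp N a (∑ k ∈ s, f k) = ∑ k ∈ s, kernelOp N a (f k) := by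
  classical
  induction s using Finset.induction_on with
  | empty =>
    have := kernelOp_C_mul N a 0 0
    simpa using this
  | insert k s hk ih => rw [Finset.sum_insert hk, Finset.sum_insert hk, kernelOp_add, ih]

lemma euler_linear (u₀ u₁ : ℂ) : euler (C u₀ + C u₁ * X) = C u₁ * X := by
  simp [euler_add, euler_mul, euler_C, euler_X, -map_add]

lemma one_add_X_mul_kernelOp {N a u₁ : ℂ} {u f : ℂ⟦X⟧} (hu : euler u = C u₁ * X)
    (h : (1 + X) * euler f = u * f) :
    (1 + X) * kernelOp N a f
      = ((1 + X) * C u₁ * X * (u + (1 - 2 * X) - 3 * (1 + X) + X + C (2 + 2 * a) * (1 + 2 * X))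
          + ((1 + X) * (2 * C u₁ * X - X)
            + (u - 2 * X - 3 * (1 + X) + C (2 + 2 * a) * (1 + 2 * X)) * (u - X)
            + 2 * (1 + X) ^ 2 - C (2 + 2 * a) * (1 + X) * (1 + 2 * X)
            + C (-2 * N * (1 + 2 * N + 2 * a))
            + C (2 + 6 * a + 4 * a ^ 2 - 4 * a * N - 4 * N ^ 2 - 2 * N) * (X + X ^ 2)) * u
          + C (-2 * N * a * (2 * a + 2 * N + 1)) * (X + 2 * X ^ 2) * (1 + X)) * f := by
  have h₁ : (1 + X) * euler (euler f) + X * euler f = C u₁ * X * f + u * euler f := by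
    have := congrArg euler h
    simp only [euler_mul, euler_add, euler_one, euler_X, hu] at this
    linear_combination this
  have h₂ : (1 + X) * euler (euler (euler f)) + 2 * X * euler (euler f) + X * euler f
      = C u₁ * X * f + 2 * (C u₁ * X) * euler f + u * euler (euler f) := by
    have := congrArg euler h₁
    simp only [euler_mul, euler_add, euler_X, euler_C, euler_one, hu] at this
    linear_combination this
  rw [kernelOp]
  linear_combination (1 + X) ^ 2 * h₂
    + (1 + X) * (u - 2 * X - 3 * (1 + X) + C (2 + 2 * a) * (1 + 2 * X)) * h₁
    + ((1 + X) * (2 * C u₁ * X - X)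
      + (u - 2 * X - 3 * (1 + X) + C (2 + 2 * a) * (1 + 2 * X)) * (u - X)
      + 2 * (1 + X) ^ 2 - C (2 + 2 * a) * (1 + X) * (1 + 2 * X)
      + C (-2 * N * (1 + 2 * N + 2 * a))
      + C (2 + 6 * a + 4 * a ^ 2 - 4 * a * N - 4 * N ^ 2 - 2 * N) * (X + X ^ 2)) * h

/-- The image of `(-X (1 + X)) ^ k` under `kernelOp`. -/
lemma one_add_X_mul_kernelOp_polynomial (N a : ℂ) (k : ℕ) :
    (1 + X) * kernelOp N a ((-(X * (1 + X))) ^ k)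
      = C (k * (k + 2 * N + 2 * a) * (k - 2 * N - 1)) * ((1 + 2 * X) * (-(X * (1 + X))) ^ k)
        - C (2 * (k - N) * (k + a) * (2 * k + 2 * a + 2 * N + 1))
          * ((1 + 2 * X) * (-(X * (1 + X))) ^ (k + 1)) := by
  have h : (1 + X) * euler ((-(X * (1 + X))) ^ k)
      = (C (k : ℂ) + C (2 * k : ℂ) * X) * (-(X * (1 + X))) ^ k := by
    induction k with
    | zero => simp [euler_one]
    | succ k ih =>
      have h0 : euler (-(X * (1 + X) : ℂ⟦X⟧)) = -(X + 2 * X ^ 2) := by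
        simp only [euler_neg, euler_mul, euler_add, euler_X, euler_one]
        ring
      rw [pow_succ, euler_mul, h0]
      simp only [map_mul, Nat.cast_succ, map_add, map_one, map_ofNat] at ih ⊢
      linear_combination (-(X * (1 + X))) * ih
  rw [one_add_X_mul_kernelOp (u₁ := 2 * k) (euler_linear _ _) h, pow_succ]
  simp only [map_mul, map_add, map_sub, map_neg, map_pow, map_one, map_ofNat]
  ring

lemma one_add_X_mul_kernelOp_binSeries (N a : ℂ) (k : ℕ) :
    (1 + X) * kernelOp N a (X ^ k * binSeries (-2 * a - 2 * k))
      = C (k * (k + 2 * N + 2 * a) * (k - 2 * N - 1))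
          * ((1 - X) * (1 + X) ^ 2 * (X ^ k * binSeries (-2 * a - 2 * k)))
        - C (2 * (k - N) * (k + a) * (2 * k + 2 * a + 2 * N + 1))
          * ((1 - X) * (1 + X) ^ 2
            * (X ^ (k + 1) * binSeries (-2 * a - 2 * (k + 1 : ℕ)))) := by
  have h : (1 + X) * euler (X ^ k * binSeries (-2 * a - 2 * k))
      = (C (k : ℂ) + C (-2 * a - k : ℂ) * X) * (X ^ k * binSeries (-2 * a - 2 * k)) := by
    have := euler_binSeries (-2 * a - 2 * k)
    rw [euler_mul, euler_X_pow]
    simp only [map_mul, map_sub, map_neg, map_ofNat] at this ⊢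
    linear_combination X ^ k * this
  have hb : binSeries (-2 * a - 2 * k)
      = (1 + X) ^ 2 * binSeries (-2 * a - 2 * (k + 1 : ℕ)) := by
    rw [← binSeries_add_natCast]
    congr 1
    push_cast
    ring
  rw [one_add_X_mul_kernelOp (u₁ := -2 * a - k) (euler_linear _ _) h, hb]
  simp only [map_mul, map_add, map_sub, map_neg, map_pow, map_one, map_ofNat]
  ring

end DifferentialEquation

section Kernel

open PowerSeries

/-- The coefficients of the hypergeometric polynomial
`₃F₂(-N, a, a + N + 1/2; 2 a + 2 N + 1, -2 N; 4 y)`. -/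
noncomputable def kerCoeff (N : ℕ) (a : ℂ) (k : ℕ) : ℂ :=
  ∏ i ∈ Finset.range k, 2 * (N - i) * (i + a) * (2 * i + 2 * a + 2 * N + 1)
    / ((i + 1) * (i + 1 + 2 * N + 2 * a) * (2 * N - i))

lemma kerCoeff_zero (N : ℕ) (a : ℂ) : kerCoeff N a 0 = 1 := by simp [kerCoeff]

lemma kerCoeff_succ_self (N : ℕ) (a : ℂ) : kerCoeff N a (N + 1) = 0 := by
  simp [kerCoeff, Finset.prod_range_succ]

lemma add_natCast_ne_zero {a : ℂ} (ha : ∀ k : ℕ, 2 * a + k ≠ 0) {x : ℂ} (k : ℕ)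
    (hx : x = 2 * a + k) : x ≠ 0 := hx ▸ ha k

lemma kerCoeff_succ {N : ℕ} {a : ℂ} (ha : ∀ k : ℕ, 2 * a + k ≠ 0) {k : ℕ} (hk : k ≤ N) :
    kerCoeff N a (k + 1) * ((k + 1) * (k + 1 + 2 * N + 2 * a) * (2 * N - k))
      = kerCoeff N a k * (2 * (N - k) * (k + a) * (2 * k + 2 * a + 2 * N + 1)) := by
  rcases hk.eq_or_lt with rfl | hk
  · simp [kerCoeff_succ_self]
  · rw [kerCoeff, Finset.prod_range_succ, ← kerCoeff]
    have h₁ : (k : ℂ) + 1 ≠ 0 := by exact_mod_cast k.succ_ne_zero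
    have h₂ : (k : ℂ) + 1 + 2 * N + 2 * a ≠ 0 :=
      add_natCast_ne_zero ha (k + 1 + 2 * N) (by push_cast; ring)
    have h₃ : 2 * (N : ℂ) - k ≠ 0 := by
      rw [sub_ne_zero]
      exact_mod_cast (by omega : 2 * N ≠ k)
    field_simp

/-- The difference of the two expansions of the kernel polynomial. -/
noncomputable def kerDiff (N : ℕ) (a : ℂ) : ℂ⟦X⟧ :=
  ∑ k ∈ Finset.range (N + 1), C (kerCoeff N a k)
    * ((-(X * (1 + X))) ^ k - X ^ k * binSeries (-2 * a - 2 * k))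

lemma kernelOp_sub (N a : ℂ) (f g : ℂ⟦X⟧) :
    kernelOp N a (f - g) = kernelOp N a f - kernelOp N a g := by
  have := kernelOp_add N a (f - g) g
  rw [sub_add_cancel] at this
  rw [this, add_sub_cancel_right]

lemma kernelOp_kerDiff {N : ℕ} {a : ℂ} (ha : ∀ k : ℕ, 2 * a + k ≠ 0) :
    kernelOp N a (kerDiff N a) = 0 := by
  have hX : (1 + X : ℂ⟦X⟧) ≠ 0 := by
    intro h
    have := congrArg (coeff 0) h
    simp at this
  apply (mul_eq_zero.1 _).resolve_left hX
  rw [kerDiff, kernelOp_sum, Finset.mul_sum]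
  let T : ℕ → ℂ⟦X⟧ := fun k =>
    C (kerCoeff N a k) * C (k * (k + 2 * N + 2 * a) * (k - 2 * N - 1))
      * ((1 + 2 * X) * (-(X * (1 + X))) ^ k
        - (1 - X) * (1 + X) ^ 2 * (X ^ k * binSeries (-2 * a - 2 * k)))
  have hT : ∀ k ∈ Finset.range (N + 1), (1 + X) * kernelOp N a (C (kerCoeff N a k)
      * ((-(X * (1 + X))) ^ k - X ^ k * binSeries (-2 * a - 2 * k))) = T k - T (k + 1) := by
    intro k hk
    have h := kerCoeff_succ ha (Finset.mem_range_succ_iff.1 hk)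
    have h' : C (kerCoeff N a (k + 1)) * C ((k + 1 : ℕ) * ((k + 1 : ℕ) + 2 * N + 2 * a)
        * ((k + 1 : ℕ) - 2 * N - 1))
        = C (kerCoeff N a k) * C (2 * (k - N) * (k + a) * (2 * k + 2 * a + 2 * N + 1)) := by
      rw [← map_mul, ← map_mul]
      congr 1
      push_cast
      linear_combination -h
    simp only [T, h']
    rw [kernelOp_C_mul, kernelOp_sub]
    have h₁ := one_add_X_mul_kernelOp_polynomial N a k
    have h₂ := one_add_X_mul_kernelOp_binSeries N a k
    linear_combination C (kerCoeff N a k) * h₁ - C (kerCoeff N a k) * h₂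
  rw [Finset.sum_congr rfl hT, Finset.sum_range_sub']
  simp [T, kerCoeff_succ_self]

lemma coeff_kernelOp_succ (N a : ℂ) (f : ℂ⟦X⟧) (hf : coeff 0 f = 0) (j : ℕ) :
    ∃ β γ : ℂ, coeff (j + 1) (kernelOp N a f)
      = (j + 1) * (j + 1 + 2 * N + 2 * a) * (j - 2 * N) * coeff (j + 1) f
        + β * coeff j f + γ * coeff (j - 1) f := by
  have h : kernelOp N a f
      = (euler (euler (euler f)) - 3 * euler (euler f) + 2 * euler f)
        + C (2 + 2 * a) * (euler (euler f) - euler f)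
        + C (-2 * N * (1 + 2 * N + 2 * a)) * euler f
        + X * (C 2 * (euler (euler (euler f)) - 3 * euler (euler f) + 2 * euler f)
          + C (3 * (2 + 2 * a)) * (euler (euler f) - euler f)
          + C (2 + 6 * a + 4 * a ^ 2 - 4 * a * N - 4 * N ^ 2 - 2 * N) * euler f
          + C (-2 * N * a * (2 * a + 2 * N + 1)) * f)
        + X * (X * ((euler (euler (euler f)) - 3 * euler (euler f) + 2 * euler f)
          + C (2 * (2 + 2 * a)) * (euler (euler f) - euler f)
          + C (2 + 6 * a + 4 * a ^ 2 - 4 * a * N - 4 * N ^ 2 - 2 * N) * euler f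
          + C (2 * (-2 * N * a * (2 * a + 2 * N + 1))) * f)) := by
    simp only [kernelOp, map_mul, map_ofNat]
    ring
  have h3 : (3 : ℂ⟦X⟧) = C 3 := (map_ofNat _ 3).symm
  have h2 : (2 : ℂ⟦X⟧) = C 2 := (map_ofNat _ 2).symm
  rw [h, h3, h2]
  generalize hc₁ : 3 * (2 + 2 * a) = c₁
  generalize hc₂ : 2 * (2 + 2 * a) = c₂
  generalize hc₃ : 2 + 2 * a = c₃
  generalize hc₄ : 2 + 6 * a + 4 * a ^ 2 - 4 * a * N - 4 * N ^ 2 - 2 * N = c₄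
  cases j with
  | zero =>
    refine ⟨0, 0, ?_⟩
    simp only [map_add, map_sub, coeff_succ_X_mul, coeff_C_mul, coeff_euler, coeff_zero_X_mul, hf]
    rw [← hc₃]
    push_cast
    ring
  | succ j =>
    simp only [map_add, map_sub, coeff_succ_X_mul, coeff_C_mul, coeff_euler]
    rw [Nat.add_sub_cancel]
    refine ⟨2 * (j + 1) * j * (j - 1) + c₁ * (j + 1) * j + c₄ * (j + 1)
      + (-2 * N * a * (2 * a + 2 * N + 1)),
      j * (j - 1) * (j - 2) + c₂ * j * (j - 1) + c₄ * j
      + 2 * (-2 * N * a * (2 * a + 2 * N + 1)), ?_⟩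
    rw [← hc₃]
    push_cast
    ring

lemma coeff_kerDiff_zero (N : ℕ) (a : ℂ) : coeff 0 (kerDiff N a) = 0 := by
  rw [kerDiff, map_sum]
  apply Finset.sum_eq_zero
  intro k _
  rw [coeff_C_mul]
  cases k with
  | zero => simp [binSeries, gbinom_zero]
  | succ k => simp [pow_succ]

lemma coeff_kerDiff {N : ℕ} {a : ℂ} (ha : ∀ k : ℕ, 2 * a + k ≠ 0) {j : ℕ} (hj : j ≤ 2 * N) :
    coeff j (kerDiff N a) = 0 := by
  induction j using Nat.strong_induction_on with
  | _ j ih =>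
    cases j with
    | zero => exact coeff_kerDiff_zero N a
    | succ j =>
      obtain ⟨β, γ, h⟩ := coeff_kernelOp_succ N a _ (coeff_kerDiff_zero N a) j
      rw [kernelOp_kerDiff ha, map_zero, ih j (by omega) (by omega),
        ih (j - 1) (by omega) (by omega), mul_zero, mul_zero, add_zero, add_zero] at h
      refine (mul_eq_zero.1 h.symm).resolve_left ?_
      refine mul_ne_zero (mul_ne_zero ?_ ?_) ?_
      · exact_mod_cast j.succ_ne_zero
      · exact add_natCast_ne_zero ha (j + 1 + 2 * N) (by push_cast; ring)
      · rw [sub_ne_zero]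
        exact_mod_cast (by omega : j ≠ 2 * N)

end Kernel

section AlternatingSums

lemma sum_alternating_choose_succ (N : ℕ) (f : ℕ → ℂ) :
    ∑ k ∈ Finset.range (N + 2), (-1) ^ k * ((N + 1).choose k : ℂ) * f k
      = ∑ k ∈ Finset.range (N + 1), (-1) ^ k * (N.choose k : ℂ) * f k
        - ∑ k ∈ Finset.range (N + 1), (-1) ^ k * (N.choose k : ℂ) * f (k + 1) := by
  have h := Finset.sum_range_succ' (fun k => (-1) ^ k * (N.choose k : ℂ) * f k) (N + 1)
  rw [Finset.sum_range_succ, Nat.choose_succ_self] at h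
  rw [Finset.sum_range_succ']
  have e : ∀ k ∈ Finset.range (N + 1), (-1) ^ (k + 1) * ((N + 1).choose (k + 1) : ℂ) * f (k + 1)
      = (-1) ^ (k + 1) * (N.choose (k + 1) : ℂ) * f (k + 1)
        - (-1) ^ k * (N.choose k : ℂ) * f (k + 1) := fun k _ => by
    rw [Nat.choose_succ_succ]
    push_cast
    ring
  rw [Finset.sum_congr rfl e, Finset.sum_sub_distrib]
  simp only [Nat.choose_zero_right] at h ⊢
  push_cast at h ⊢
  linear_combination -h

lemma poch_succ' (x : ℂ) (n : ℕ) : poch x (n + 1) = x * poch (x + 1) n := by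
  rw [add_comm, poch_add]
  simp [poch]

lemma poch_add_one_mul (x : ℂ) (n : ℕ) : poch (x + 1) n * x = poch x n * (x + n) := by
  rw [← poch_succ, poch_succ', mul_comm]

lemma sum_alternating_choose_poch (N n : ℕ) (b : ℂ) (h : n < N) :
    ∑ k ∈ Finset.range (N + 1), (-1) ^ k * (N.choose k : ℂ) * poch (b + k) n = 0 := by
  induction N generalizing n b with
  | zero => omega
  | succ N ih =>
    rw [sum_alternating_choose_succ, ← Finset.sum_sub_distrib]
    cases n with
    | zero => simp [poch_zero]
    | succ n =>
      rw [← mul_zero (-(n + 1 : ℂ)), ← ih n (b + 1) (by omega), Finset.mul_sum]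
      refine Finset.sum_congr rfl fun k _ => ?_
      have h1 := poch_succ' (b + k) n
      have h2 := poch_succ (b + k + 1) n
      have e1 : b + ((k + 1 : ℕ) : ℂ) = b + k + 1 := by push_cast; ring
      have e2 : b + 1 + (k : ℂ) = b + k + 1 := by ring
      rw [e1, e2, h1, h2]
      ring

lemma sum_alternating_choose_poch_div (N n : ℕ) (b z : ℂ) (h : n ≤ N)
    (hz : ∀ k ≤ N, z - (k : ℂ) ≠ 0) :
    (∑ k ∈ Finset.range (N + 1), (-1) ^ k * (N.choose k : ℂ) * (poch (b + k) n / (z - k)))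
        * ∏ k ∈ Finset.range (N + 1), (z - (k : ℂ))
      = (-1) ^ N * N.factorial * poch (b + z) n := by
  induction N generalizing n b z with
  | zero =>
    obtain rfl : n = 0 := by omega
    have := hz 0 le_rfl
    simp [poch_zero] at this ⊢
    exact inv_mul_cancel₀ this
  | succ N ih =>
    have main : ∀ n ≤ N, (∑ k ∈ Finset.range (N + 2), (-1) ^ k * ((N + 1).choose k : ℂ)
          * (poch (b + k) n / (z - k))) * ∏ k ∈ Finset.range (N + 2), (z - (k : ℂ))
        = (-1) ^ (N + 1) * (N + 1).factorial * poch (b + z) n := by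
      intro n hn
      have h1 := ih n b z hn fun k hk => hz k (by omega)
      have h2 := ih n (b + 1) (z - 1) hn fun k hk => by
        have := hz (k + 1) (by omega)
        rw [sub_sub, add_comm 1]
        exact_mod_cast this
      have e : ∀ k : ℕ, poch (b + 1 + k) n / (z - 1 - k)
          = poch (b + (k + 1 : ℕ)) n / (z - (k + 1 : ℕ)) := fun k => by
        rw [Nat.cast_succ, show b + 1 + (k : ℂ) = b + (k + 1) by ring,
          show z - 1 - (k : ℂ) = z - (k + 1) by ring]
      simp only [e] at h2
      have hp1 := Finset.prod_range_succ (fun k : ℕ => z - (k : ℂ)) (N + 1)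
      have hp2 := Finset.prod_range_succ' (fun k : ℕ => z - (k : ℂ)) (N + 1)
      have hp3 : ∏ k ∈ Finset.range (N + 1), (z - ((k + 1 : ℕ) : ℂ))
          = ∏ k ∈ Finset.range (N + 1), (z - 1 - (k : ℂ)) :=
        Finset.prod_congr rfl fun k _ => by push_cast; ring
      rw [hp3] at hp2
      have e2 : b + 1 + (z - 1) = b + z := by ring
      rw [e2] at h2
      rw [sum_alternating_choose_succ, sub_mul]
      nth_rewrite 1 [hp1]
      rw [hp2, Nat.factorial_succ]
      push_cast at *
      linear_combination (z - (N + 1)) * h1 - z * h2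
    rcases h.lt_or_eq with h | rfl
    · exact main n (by omega)
    · have h0 := sum_alternating_choose_poch (N + 1) N b (by omega)
      have h1 := main N le_rfl
      have e : ∀ k ∈ Finset.range (N + 2), (-1) ^ k * ((N + 1).choose k : ℂ)
            * (poch (b + k) (N + 1) / (z - k))
          = (b + z + N) * ((-1) ^ k * ((N + 1).choose k : ℂ) * (poch (b + k) N / (z - k)))
            - (-1) ^ k * ((N + 1).choose k : ℂ) * poch (b + k) N := by
        intro k hk
        have := hz k (Finset.mem_range_succ_iff.1 hk)
        rw [poch_succ]
        field_simp
        ring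
      rw [Finset.sum_congr rfl e, Finset.sum_sub_distrib, ← Finset.mul_sum, h0, poch_succ]
      linear_combination (b + z + N) * h1

end AlternatingSums

section KernelValue

open PowerSeries

lemma gbinom_sub_two (x : ℂ) (m : ℕ) :
    gbinom (x - 2) m * (x * (x - 1)) = gbinom x (m + 1) * ((m + 1) * (x - 1 - m)) := by
  have key : ∀ (y : ℂ) (m : ℕ), gbinom y m * (y + 1) = gbinom (y + 1) (m + 1) * (m + 1) := by
    intro y m
    have h1 := gbinom_pascal y m
    have h2 := gbinom_succ y m
    rw [h1]
    linear_combination -h2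
  have h1 := key (x - 2) m
  have h2 := key (x - 1) m
  have h3 := gbinom_succ (x - 1) m
  rw [show x - 2 + 1 = x - 1 by ring] at h1
  rw [sub_add_cancel] at h2
  linear_combination x * h1 + x * h3 + (x - 1 - m) * h2

lemma kerCoeff_mul_gbinom {N : ℕ} {a : ℂ} (ha : ∀ k : ℕ, 2 * a + k ≠ 0) {k : ℕ} (hk : k ≤ N) :
    kerCoeff N a k * gbinom (-2 * a - 2 * k) (2 * N + 1 - k) * poch (a + 1 / 2) N
        * (2 * N + 1 - k)
      = -(poch (2 * a) (2 * N + 1) / (2 * N + 1).factorial) * ((-1) ^ k * (N.choose k : ℂ)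
        * poch (a + 1 / 2 + k) N) * (2 * N + 1) := by
  induction k with
  | zero =>
    have h := gbinom_neg (2 * a) (2 * N + 1)
    rw [pow_succ, pow_mul] at h
    simp only [kerCoeff_zero, Nat.sub_zero, Nat.choose_zero_right, pow_zero, Nat.cast_zero,
      mul_zero, sub_zero, add_zero, Nat.cast_one]
    rw [neg_mul, h]
    ring
  | succ k ih =>
    have ih := ih (by omega)
    have h1 := kerCoeff_succ ha (show k ≤ N by omega)
    have h2 := gbinom_sub_two (-2 * a - 2 * k) (2 * N - k)
    have h3 : ((N.choose (k + 1) : ℕ) : ℂ) * (k + 1) = N.choose k * (N - k) := by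
      have := Nat.choose_succ_right_eq N k
      have h' := congrArg (Nat.cast : ℕ → ℂ) this
      push_cast [Nat.cast_sub (show k ≤ N by omega)] at h'
      exact h'
    have h4 := poch_add_one_mul (a + 1 / 2 + k) N
    have e1 : 2 * N + 1 - (k + 1) = 2 * N - k := by omega
    have e2 : 2 * N - k + 1 = 2 * N + 1 - k := by omega
    have e3 : -2 * a - 2 * ((k + 1 : ℕ) : ℂ) = -2 * a - 2 * k - 2 := by push_cast; ring
    have e4 : a + 1 / 2 + ((k + 1 : ℕ) : ℂ) = a + 1 / 2 + k + 1 := by push_cast; ring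
    rw [e2, Nat.cast_sub (show k ≤ 2 * N by omega)] at h2
    rw [e1, e3, e4]
    push_cast at h2 ⊢
    have n1 : (k : ℂ) + 1 ≠ 0 := by exact_mod_cast k.succ_ne_zero
    have n2 : (k : ℂ) + 1 + 2 * N + 2 * a ≠ 0 :=
      add_natCast_ne_zero ha (k + 1 + 2 * N) (by push_cast; ring)
    have n3 : 2 * a + 2 * k ≠ 0 := add_natCast_ne_zero ha (2 * k) (by push_cast; ring)
    have n4 : 2 * a + 2 * k + 1 ≠ 0 := add_natCast_ne_zero ha (2 * k + 1) (by push_cast; ring)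
    apply mul_right_cancel₀ (mul_ne_zero (mul_ne_zero n1 n2) (mul_ne_zero n3 n4))
    generalize gbinom (-2 * a - 2 * k - 2) (2 * N - k) = G' at *
    generalize gbinom (-2 * a - 2 * k) (2 * N + 1 - k) = G at *
    generalize kerCoeff N a (k + 1) = K' at *
    generalize kerCoeff N a k = K at *
    generalize poch (a + 1 / 2 + k + 1) N = P' at *
    generalize poch (a + 1 / 2 + k) N = P at *
    generalize poch (a + 1 / 2) N = Q at *
    generalize poch (2 * a) (2 * N + 1) / (2 * N + 1).factorial = g at *
    generalize ((N.choose (k + 1) : ℕ) : ℂ) = B' at *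
    generalize ((N.choose k : ℕ) : ℂ) = B at *
    generalize hs : (-1 : ℂ) ^ k = s at *
    rw [pow_succ, hs]
    linear_combination (G' * Q * (2 * a + 2 * k) * (2 * a + 2 * k + 1)) * h1
      + (K * (2 * (N - k) * (k + a) * (2 * k + 2 * a + 2 * N + 1)) * Q) * h2
      + (-(2 * (N - k) * (k + a) * (2 * k + 2 * a + 2 * N + 1)) * (2 * a + k + 2 * N + 1)) * ih
      - (2 * N + 1) * (k + 1 + 2 * N + 2 * a) * (2 * a + 2 * k) * g * s *
        (P' * (2 * a + 2 * k + 1) * h3 + B * (N - k) * 2 * h4)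

lemma prod_range_cast_sub_mul_factorial (M m : ℕ) (h : m ≤ M) :
    (∏ i ∈ Finset.range m, ((M : ℂ) - i)) * (M - m).factorial = M.factorial := by
  induction m with
  | zero => simp
  | succ m ih =>
    rw [← ih (by omega), Finset.prod_range_succ, show M - m = M - (m + 1) + 1 by omega,
      Nat.factorial_succ, show M - (m + 1) + 1 = M - m by omega]
    push_cast [Nat.cast_sub (show m ≤ M by omega)]
    ring

lemma coeff_neg_X_mul_one_add_X_pow {k j : ℕ} (h : 2 * k < j) :
    coeff j ((-(X * (1 + X)) : ℂ⟦X⟧) ^ k) = 0 := by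
  have e : (-(X * (1 + X)) : ℂ⟦X⟧) ^ k = C ((-1) ^ k) * (X ^ k * binSeries k) := by
    have := binSeries_add_natCast 0 k
    rw [zero_add, binSeries_zero, mul_one] at this
    rw [this, neg_pow, mul_pow]
    simp
  rw [e, coeff_C_mul, show j = j - k + k by omega, coeff_X_pow_mul, binSeries, coeff_mk,
    gbinom_natCast, Nat.choose_eq_zero_of_lt (by omega)]
  simp

lemma coeff_kerDiff_two_mul_add_one {N : ℕ} {a : ℂ} (ha : ∀ k : ℕ, 2 * a + k ≠ 0) :
    coeff (2 * N + 1) (kerDiff N a) * poch (a + 1 / 2) N * (2 * N).factorial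
      = (-1) ^ N * (poch (2 * a) (2 * N + 1) / (2 * N + 1).factorial) * N.factorial ^ 2
        * poch (a + 2 * N + 3 / 2) N := by
  have hne : ∀ k ≤ N, (2 * N + 1 : ℂ) - (k : ℂ) ≠ 0 := fun k hk => by
    rw [sub_ne_zero]
    exact_mod_cast (by omega : 2 * N + 1 ≠ k)
  have hsum := sum_alternating_choose_poch_div N N (a + 1 / 2) (2 * N + 1) le_rfl hne
  rw [show a + 1 / 2 + (2 * (N : ℂ) + 1) = a + 2 * N + 3 / 2 by ring] at hsum
  have hprod := prod_range_cast_sub_mul_factorial (2 * N + 1) (N + 1) (by omega)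
  rw [show 2 * N + 1 - (N + 1) = N by omega] at hprod
  push_cast at hprod
  have hc : coeff (2 * N + 1) (kerDiff N a) * poch (a + 1 / 2) N
      = poch (2 * a) (2 * N + 1) / (2 * N + 1).factorial * (2 * N + 1)
        * ∑ k ∈ Finset.range (N + 1), (-1) ^ k * (N.choose k : ℂ)
          * (poch (a + 1 / 2 + k) N / (2 * N + 1 - k)) := by
    rw [kerDiff, map_sum, Finset.sum_mul, Finset.mul_sum]
    refine Finset.sum_congr rfl fun k hk => ?_
    have hk := Finset.mem_range_succ_iff.1 hk
    have h := kerCoeff_mul_gbinom ha hk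
    have hn := hne k hk
    rw [coeff_C_mul, map_sub, coeff_neg_X_mul_one_add_X_pow (by omega)]
    nth_rewrite 1 [show 2 * N + 1 = 2 * N + 1 - k + k by omega]
    rw [coeff_X_pow_mul, binSeries, coeff_mk]
    apply mul_right_cancel₀ hn
    have e : ∀ x y z w : ℂ, x * (z * (w / (2 * N + 1 - k))) * (2 * N + 1 - k) = x * z * w := by
      intro x y z w
      field_simp
    rw [e _ 0]
    linear_combination -h
  have hf : ((2 * N + 1).factorial : ℂ) = (2 * N + 1) * (2 * N).factorial := by
    rw [Nat.factorial_succ]; push_cast; ring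
  have hN : (N.factorial : ℂ) ≠ 0 := by exact_mod_cast N.factorial_ne_zero
  have h2N : ((2 * N).factorial : ℂ) ≠ 0 := by exact_mod_cast (2 * N).factorial_ne_zero
  have hp : ∏ k ∈ Finset.range (N + 1), ((2 * N + 1 : ℂ) - k) ≠ 0 :=
    Finset.prod_ne_zero_iff.2 fun k hk => hne k (Finset.mem_range_succ_iff.1 hk)
  rw [hc]
  apply mul_right_cancel₀ hp
  generalize poch (2 * a) (2 * N + 1) / (2 * N + 1).factorial = g at *
  generalize ∑ k ∈ Finset.range (N + 1), (-1) ^ k * (N.choose k : ℂ)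
          * (poch (a + 1 / 2 + k) N / (2 * N + 1 - k)) = S at *
  generalize ∏ k ∈ Finset.range (N + 1), ((2 * N + 1 : ℂ) - k) = R at *
  rw [hf] at hprod
  linear_combination g * (2 * N + 1) * (2 * N).factorial * hsum
    - g * (-1) ^ N * poch (a + 2 * N + 3 / 2) N * N.factorial * hprod

end KernelValue

section SkewMatrix

/-- The weights `(-1) ^ j j! / (2 a)_j`. -/
noncomputable def skewWeight (a : ℂ) (j : ℕ) : ℂ := (-1) ^ j * j.factorial / poch (2 * a) j

/-- A skew-symmetric kernel on `ℕ × ℕ`. -/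
noncomputable def skewEntry (a : ℂ) (i j : ℕ) : ℂ :=
  skewWeight a i * (j.choose i : ℂ) - skewWeight a j * (i.choose j : ℂ)

/-- The coefficients of `∑ k, kerCoeff N a k * (X * (1 - X)) ^ k`. -/
noncomputable def kerVec (N : ℕ) (a : ℂ) (i : ℕ) : ℂ :=
  ∑ k ∈ Finset.range (N + 1),
    kerCoeff N a k * ((Polynomial.X * (1 - Polynomial.X) : Polynomial ℂ) ^ k).coeff i

lemma skewEntry_swap (a : ℂ) (i j : ℕ) : skewEntry a j i = -skewEntry a i j := by
  simp [skewEntry]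

lemma skewEntry_succ_zero (a : ℂ) (j : ℕ) : skewEntry a (j + 1) 0 = -1 := by
  simp [skewEntry, skewWeight, poch_zero]

lemma sum_coeff_X_pow_mul_one_sub_X_pow {R : Type*} [CommRing R] [Algebra ℂ R] (F : ℕ → R)
    (G : ℕ → ℕ → R) (h0 : ∀ m, G m 0 = F m) (hs : ∀ m k, G m (k + 1) = G m k - G (m + 1) k)
    (m k M : ℕ) (h : m + k < M) :
    ∑ i ∈ Finset.range M, algebraMap ℂ R
      ((Polynomial.X ^ m * (1 - Polynomial.X) ^ k : Polynomial ℂ).coeff i) * F i = G m k := by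
  induction k generalizing m with
  | zero =>
    rw [h0]
    simp only [pow_zero, mul_one, Polynomial.coeff_X_pow]
    rw [Finset.sum_eq_single_of_mem m (Finset.mem_range.2 (by omega))]
    · simp
    · intro b _ hb
      simp [hb]
  | succ k ih =>
    rw [hs, ← ih m (by omega), ← ih (m + 1) (by omega), ← Finset.sum_sub_distrib]
    refine Finset.sum_congr rfl fun i _ => ?_
    have e : (Polynomial.X ^ m * (1 - Polynomial.X) ^ (k + 1) : Polynomial ℂ)
        = Polynomial.X ^ m * (1 - Polynomial.X) ^ k
          - Polynomial.X ^ (m + 1) * (1 - Polynomial.X) ^ k := by ring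
    rw [e, Polynomial.coeff_sub, map_sub, sub_mul]

lemma sum_kerVec_mul {R : Type*} [CommRing R] [Algebra ℂ R] (N : ℕ) (a : ℂ) (F : ℕ → R)
    (G : ℕ → ℕ → R) (h0 : ∀ m, G m 0 = F m) (hs : ∀ m k, G m (k + 1) = G m k - G (m + 1) k)
    (M : ℕ) (h : 2 * N < M) :
    ∑ i ∈ Finset.range M, algebraMap ℂ R (kerVec N a i) * F i
      = ∑ k ∈ Finset.range (N + 1), algebraMap ℂ R (kerCoeff N a k) * G k k := by
  simp only [kerVec, map_sum, Finset.sum_mul, map_mul]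
  rw [Finset.sum_comm]
  refine Finset.sum_congr rfl fun k hk => ?_
  have hk := Finset.mem_range_succ_iff.1 hk
  rw [← sum_coeff_X_pow_mul_one_sub_X_pow F G h0 hs k k M (by omega), Finset.mul_sum]
  refine Finset.sum_congr rfl fun i _ => ?_
  rw [mul_pow, mul_assoc]

lemma kerVec_zero (N : ℕ) (a : ℂ) : kerVec N a 0 = 1 := by
  rw [kerVec, Finset.sum_range_succ']
  simp [Polynomial.coeff_zero_eq_eval_zero, kerCoeff_zero]

lemma natDegree_X_mul_one_sub_X :
    (Polynomial.X * (1 - Polynomial.X) : Polynomial ℂ).natDegree ≤ 2 := by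
  compute_degree

lemma kerVec_of_lt {N : ℕ} (a : ℂ) {i : ℕ} (hi : 2 * N < i) : kerVec N a i = 0 := by
  refine Finset.sum_eq_zero fun k hk => ?_
  have hk := Finset.mem_range_succ_iff.1 hk
  have := Polynomial.natDegree_pow_le_of_le k natDegree_X_mul_one_sub_X
  rw [Polynomial.coeff_eq_zero_of_natDegree_lt (by omega), mul_zero]

lemma kerVec_two_mul (N : ℕ) (a : ℂ) : kerVec N a (2 * N) = (-1) ^ N * kerCoeff N a N := by
  rw [kerVec, Finset.sum_range_succ, Finset.sum_eq_zero, zero_add, mul_comm 2 N,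
    Polynomial.coeff_pow_of_natDegree_le natDegree_X_mul_one_sub_X, mul_comm]
  · congr 2
    rw [Polynomial.coeff_X_mul (n := 1)]
    simp [Polynomial.coeff_one]
  · intro k hk
    have hk := Finset.mem_range.1 hk
    have := Polynomial.natDegree_pow_le_of_le k natDegree_X_mul_one_sub_X
    rw [Polynomial.coeff_eq_zero_of_natDegree_lt (by omega), mul_zero]

lemma sum_kerVec (N : ℕ) (a : ℂ) : ∑ i ∈ Finset.range (2 * N + 1), kerVec N a i = 1 := by
  have := sum_kerVec_mul N a (fun _ => (1 : ℂ)) (fun _ k => if k = 0 then 1 else 0)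
    (by simp) (by simp) (2 * N + 1) (by omega)
  rw [Finset.sum_eq_single_of_mem (s := Finset.range (N + 1)) 0 (by simp) (by simp +contextual)]
    at this
  simpa [kerCoeff_zero] using this

lemma poch_two_mul_ne_zero {a : ℂ} (ha : ∀ k : ℕ, 2 * a + k ≠ 0) (j : ℕ) : poch (2 * a) j ≠ 0 :=
  poch_ne_zero fun i _ => ha i

lemma skewWeight_mul_choose {a : ℂ} (ha : ∀ k : ℕ, 2 * a + k ≠ 0) {i j : ℕ} (h : i ≤ j) :
    skewWeight a i * (j.choose i : ℂ) = skewWeight a j * gbinom (-2 * a - i) (j - i) := by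
  obtain ⟨l, rfl⟩ := Nat.exists_eq_add_of_le h
  have h1 := poch_add (2 * a) i l
  have h2 : poch (2 * a) i ≠ 0 := poch_two_mul_ne_zero ha i
  have h3 : poch (2 * a + i) l ≠ 0 :=
    right_ne_zero_of_mul (h1 ▸ poch_two_mul_ne_zero ha (i + l))
  have h4 : (i.factorial : ℂ) ≠ 0 := by exact_mod_cast i.factorial_ne_zero
  have h5 : (l.factorial : ℂ) ≠ 0 := by exact_mod_cast l.factorial_ne_zero
  have h6 : ((i + l).choose i : ℂ) * i.factorial * l.factorial = (i + l).factorial := by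
    rw [Nat.choose_symm_add]
    exact_mod_cast Nat.add_choose_mul_factorial_mul_factorial i l
  have h7 : ((-1 : ℂ) ^ l) * (-1) ^ l = 1 := by rw [← mul_pow]; simp
  rw [show -2 * a - (i : ℂ) = -(2 * a + i) by ring, gbinom_neg, Nat.add_sub_cancel_left,
    skewWeight, skewWeight, h1, ← h6, pow_add]
  field_simp
  linear_combination -((i + l).choose i : ℂ) * h7

open PowerSeries in
lemma sum_skewEntry_mul_kerVec {N : ℕ} {a : ℂ} (ha : ∀ k : ℕ, 2 * a + k ≠ 0) (j M : ℕ)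
    (hM : 2 * N < M) :
    ∑ i ∈ Finset.range M, skewEntry a j i * kerVec N a i
      = skewWeight a j * coeff j (kerDiff N a) := by
  have h1 := sum_kerVec_mul (R := ℂ⟦X⟧) N a (fun i => (1 + X) ^ i)
    (fun m k => (1 + X) ^ m * (-X) ^ k) (by simp) (by intros; ring) M hM
  have h2 := sum_kerVec_mul (R := ℂ⟦X⟧) N a (fun i => X ^ i * binSeries (-2 * a - i))
    (fun m k => X ^ m * binSeries (-2 * a - m - k)) (by simp) (by
      intro m k
      have := binSeries_add_one (-2 * a - m - k - 1)
      rw [sub_add_cancel] at this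
      push_cast
      rw [this, show -2 * a - ((m : ℂ) + 1) - k = -2 * a - m - k - 1 by ring,
        show -2 * a - (m : ℂ) - (k + 1) = -2 * a - m - k - 1 by ring]
      ring) M hM
  have h3 : kerDiff N a = ∑ i ∈ Finset.range M, C (kerVec N a i)
      * ((1 + X) ^ i - X ^ i * binSeries (-2 * a - i)) := by
    simp only [mul_sub, Finset.sum_sub_distrib]
    rw [PowerSeries.algebraMap_eq] at h1 h2
    rw [h1, h2, ← Finset.sum_sub_distrib, kerDiff]
    refine Finset.sum_congr rfl fun k _ => ?_
    rw [← mul_sub, ← mul_pow, show (1 + X : ℂ⟦X⟧) * -X = -(X * (1 + X)) by ring,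
      show -2 * a - (k : ℂ) - k = -2 * a - 2 * k by ring]
  rw [h3, map_sum, Finset.mul_sum]
  refine Finset.sum_congr rfl fun i _ => ?_
  rw [coeff_C_mul, map_sub, skewEntry]
  have h4 : coeff j ((1 + X : ℂ⟦X⟧) ^ i) = i.choose j := by
    have := binSeries_add_natCast 0 i
    rw [zero_add, binSeries_zero, mul_one] at this
    rw [← this, binSeries, coeff_mk, gbinom_natCast]
  have h5 : skewWeight a j * coeff j (X ^ i * binSeries (-2 * a - i))
      = skewWeight a i * j.choose i := by
    rw [coeff_X_pow_mul']
    split_ifs with h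
    · rw [skewWeight_mul_choose ha h, binSeries, coeff_mk]
    · rw [Nat.choose_eq_zero_of_lt (by omega)]
      simp
  rw [h4]
  linear_combination kerVec N a i * h5

end SkewMatrix

section Condensation

open Matrix

lemma det_mul_sq_eq_of_mulVec_eq_single {R : Type*} [CommRing R] {n : ℕ}
    (M : Matrix (Fin (n + 2)) (Fin (n + 2)) R) (v : Fin (n + 2) → R) (ρ : R)
    (hM : M *ᵥ v = Pi.single (Fin.last _) ρ) (hM' : v ᵥ* M = Pi.single (Fin.last _) (-ρ))
    (hv : v (Fin.last _) = 0) (l : Fin (n + 1)) :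
    M.det * v l.castSucc ^ 2 = ρ ^ 2
      * (M.submatrix (fun i => (l.succAbove i).castSucc) (fun i => (l.succAbove i).castSucc)).det := by
  set B := M.submatrix (Fin.last (n + 1)).succAbove l.castSucc.succAbove with hB
  have h1 : M.det * v l.castSucc = (-1) ^ (n + 1 + (l : ℕ)) * B.det * ρ := by
    have h := congrFun (congrArg (fun w => M.adjugate *ᵥ w) hM) l.castSucc
    simp only [mulVec_mulVec, adjugate_mul, smul_mulVec, one_mulVec, Pi.smul_apply, smul_eq_mul,
      mulVec_single, MulOpposite.smul_eq_mul_unop] at h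
    rw [h, col_apply, adjugate_fin_succ_eq_det_submatrix]
    simp [hB]
  have h2 : (fun i : Fin (n + 1) => v i.castSucc) ᵥ* B = Pi.single (Fin.last n) (-ρ) := by
    ext c
    have h := congrFun hM' (l.castSucc.succAbove c)
    simp only [vecMul, dotProduct] at h ⊢
    rw [Fin.sum_univ_castSucc, hv, zero_mul, add_zero] at h
    simp only [hB, submatrix_apply, Fin.succAbove_last, h]
    have hl : l.castSucc.succAbove (Fin.last n) = Fin.last (n + 1) := by
      simp
    simp only [Pi.single_apply, ← hl, Fin.succAbove_right_inj]
  have h3 : B.det * v l.castSucc = -ρ * ((-1) ^ (n + (l : ℕ))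
      * (M.submatrix (fun i => (l.succAbove i).castSucc) (fun i => (l.succAbove i).castSucc)).det) := by
    have h := congrFun (congrArg (fun w => w ᵥ* B.adjugate) h2) l
    simp only [vecMul_vecMul, mul_adjugate, vecMul_smul, vecMul_one, Pi.smul_apply, smul_eq_mul,
      single_vecMul] at h
    rw [h, row_apply, adjugate_fin_succ_eq_det_submatrix]
    have e : B.submatrix l.succAbove (Fin.last n).succAbove
        = M.submatrix (fun i => (l.succAbove i).castSucc) (fun i => (l.succAbove i).castSucc) := by
      ext i j
      simp [hB, Fin.castSucc_succAbove_castSucc]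
    rw [e]
    simp [add_comm]
  have h4 : ((-1 : R) ^ (n + (l : ℕ))) * (-1) ^ (n + (l : ℕ)) = 1 := by rw [← mul_pow]; simp
  rw [show n + 1 + (l : ℕ) = n + l + 1 by omega, pow_succ] at h1
  linear_combination v l.castSucc * h1 - (-1) ^ (n + (l : ℕ)) * ρ * h3
    + ρ ^ 2 * (M.submatrix (fun i => (l.succAbove i).castSucc)
      (fun i => (l.succAbove i).castSucc)).det * h4

end Condensation

section SkewDet

open Matrix

/-- The determinant of the diagonal block of `skewEntry` of size `n` starting at index `s`. -/
noncomputable def skewDet (a : ℂ) (s n : ℕ) : ℂ :=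
  (of fun i j : Fin n => skewEntry a (i + s) (j + s)).det

/-- The last entry of the image of `kerVec` under the skew-symmetric kernel. -/
noncomputable def kerRes (N : ℕ) (a : ℂ) : ℂ :=
  skewWeight a (2 * N + 1) * PowerSeries.coeff (2 * N + 1) (kerDiff N a)

lemma kerRes_mul {N : ℕ} {a : ℂ} (ha : ∀ k : ℕ, 2 * a + k ≠ 0) :
    kerRes N a * poch (a + 1 / 2) N * (2 * N).factorial
      = (-1) ^ (N + 1) * N.factorial ^ 2 * poch (a + 2 * N + 3 / 2) N := by
  have h := coeff_kerDiff_two_mul_add_one (N := N) ha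
  have h1 := poch_two_mul_ne_zero ha (2 * N + 1)
  have h2 : ((2 * N + 1).factorial : ℂ) ≠ 0 := by exact_mod_cast (2 * N + 1).factorial_ne_zero
  have h3 : skewWeight a (2 * N + 1) * (poch (2 * a) (2 * N + 1) / (2 * N + 1).factorial) = -1 := by
    rw [skewWeight, pow_succ, pow_mul]
    field_simp
    simp
  rw [kerRes]
  linear_combination skewWeight a (2 * N + 1) * h
    + (-1) ^ N * N.factorial ^ 2 * poch (a + 2 * N + 3 / 2) N * h3

lemma poch_half_ne_zero {a : ℂ} (ha : ∀ k : ℕ, 2 * a + k ≠ 0) {b : ℂ} (m n : ℕ)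
    (hb : 2 * b = 2 * a + m) : poch b n ≠ 0 := poch_ne_zero fun i _ h =>
  ha (m + 2 * i) (by push_cast; linear_combination 2 * h - hb)

lemma kerRes_ne_zero {N : ℕ} {a : ℂ} (ha : ∀ k : ℕ, 2 * a + k ≠ 0) : kerRes N a ≠ 0 := by
  intro h
  have h1 := kerRes_mul (N := N) ha
  have h2 : poch (a + 2 * N + 3 / 2) N ≠ 0 :=
    poch_half_ne_zero ha (4 * N + 3) N (by push_cast; ring)
  have h3 : (N.factorial : ℂ) ≠ 0 := by exact_mod_cast N.factorial_ne_zero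
  rw [h, zero_mul, zero_mul] at h1
  exact mul_ne_zero (mul_ne_zero (pow_ne_zero _ (by simp)) (pow_ne_zero _ h3)) h2 h1.symm

lemma sum_skewEntry_mul_kerVec_eq_zero {N : ℕ} {a : ℂ} (ha : ∀ k : ℕ, 2 * a + k ≠ 0) {j M : ℕ}
    (hj : j ≤ 2 * N) (hM : 2 * N < M) :
    ∑ i ∈ Finset.range M, skewEntry a j i * kerVec N a i = 0 := by
  rw [sum_skewEntry_mul_kerVec ha j M hM, coeff_kerDiff ha hj, mul_zero]

lemma skewDet_mul_kerVec_sq {N : ℕ} {a : ℂ} (ha : ∀ k : ℕ, 2 * a + k ≠ 0) (l : Fin (2 * N + 1)) :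
    skewDet a 0 (2 * N + 2) * kerVec N a l ^ 2 = kerRes N a ^ 2
      * (of fun i j : Fin (2 * N) => skewEntry a (l.succAbove i) (l.succAbove j)).det := by
  set M : Matrix (Fin (2 * N + 2)) (Fin (2 * N + 2)) ℂ := of fun i j => skewEntry a i j with hMdef
  have hM : M *ᵥ (fun i => kerVec N a i) = Pi.single (Fin.last _) (kerRes N a) := by
    ext j
    simp only [mulVec, dotProduct, hMdef, of_apply]
    rw [Fin.sum_univ_eq_sum_range (fun i => skewEntry a j i * kerVec N a i)]
    refine Fin.lastCases ?_ (fun j => ?_) j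
    · rw [sum_skewEntry_mul_kerVec ha _ _ (by omega), Pi.single_eq_same]
      rfl
    · rw [Pi.single_eq_of_ne (Fin.castSucc_ne_last j),
        sum_skewEntry_mul_kerVec_eq_zero ha _ (by omega)]
      have := j.is_lt
      simp only [Fin.val_castSucc]
      omega
  have hM' : (fun i : Fin (2 * N + 2) => kerVec N a i) ᵥ* M
      = Pi.single (Fin.last _) (-kerRes N a) := by
    have hT : Mᵀ = -M := by
      ext i j
      simp [hMdef, skewEntry_swap a i j]
    rw [← mulVec_transpose, hT, neg_mulVec, hM, Pi.single_neg]
  have h := det_mul_sq_eq_of_mulVec_eq_single M _ _ hM hM' (kerVec_of_lt a (by simp)) l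
  exact h

lemma skewDet_zero_add_two {N : ℕ} {a : ℂ} (ha : ∀ k : ℕ, 2 * a + k ≠ 0) :
    skewDet a 0 (2 * N + 2) = kerRes N a ^ 2 * skewDet a 1 (2 * N) := by
  have h := skewDet_mul_kerVec_sq (N := N) ha 0
  rw [Fin.val_zero, kerVec_zero] at h
  simpa [skewDet] using h

lemma skewDet_one_mul {N : ℕ} {a : ℂ} (ha : ∀ k : ℕ, 2 * a + k ≠ 0) :
    skewDet a 1 (2 * N) * kerCoeff N a N ^ 2 = skewDet a 0 (2 * N) := by
  have h := skewDet_mul_kerVec_sq (N := N) ha (Fin.last _)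
  rw [Fin.val_last, kerVec_two_mul, skewDet_zero_add_two ha, mul_pow, ← pow_mul, mul_comm N,
    pow_mul, neg_one_sq, one_pow, one_mul, mul_assoc] at h
  have h := mul_left_cancel₀ (pow_ne_zero 2 (kerRes_ne_zero ha)) h
  simpa [skewDet] using h

lemma skewDet_one_succ {N : ℕ} {a : ℂ} (ha : ∀ k : ℕ, 2 * a + k ≠ 0) :
    skewDet a 1 (2 * (N + 1)) * kerCoeff (N + 1) a (N + 1) ^ 2
      = kerRes N a ^ 2 * skewDet a 1 (2 * N) := by
  rw [skewDet_one_mul ha, ← skewDet_zero_add_two ha]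
  rfl

end SkewDet

section Factorization

open Matrix

lemma gbinom_neg_eq (x : ℂ) (m : ℕ) : gbinom (-x) m = (-1) ^ m * gbinom (x + m - 1) m := by
  rw [gbinom_neg, poch, gbinom, ← Finset.prod_range_reflect]
  congr 2
  refine Finset.prod_congr rfl fun i hi => ?_
  have hi := Finset.mem_range.1 hi
  rw [Nat.cast_sub (by omega), Nat.cast_sub (by omega)]
  push_cast
  ring

open PowerSeries in
lemma one_add_pow_eq_sum {I n : ℕ} (h : I ≤ n) (f : ℂ⟦X⟧) :
    (1 + f) ^ I = ∑ k ∈ Finset.range (n + 1), PowerSeries.C (I.choose k : ℂ) * f ^ k := by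
  rw [add_comm 1 f, add_pow]
  simp only [one_pow, mul_one]
  rw [← Finset.sum_subset (Finset.range_mono (Nat.succ_le_succ h))]
  · refine Finset.sum_congr rfl fun k _ => ?_
    rw [mul_comm, map_natCast]
  · intro k _ hk
    rw [Nat.choose_eq_zero_of_lt (by simpa using hk)]
    simp

open PowerSeries in
lemma sum_choose_mul_choose {I n : ℕ} (h : I ≤ n) (j : ℕ) :
    ∑ k ∈ Finset.range (n + 1), (I.choose k : ℂ) * ((-1) ^ k * (k.choose j : ℂ))
      = if I = j then (-1) ^ I else 0 := by
  have h1 := one_add_pow_eq_sum h (-(1 + X))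
  have h2 := congrArg (coeff j) h1
  rw [show (1 + -(1 + X) : ℂ⟦X⟧) = -X by ring, map_sum] at h2
  have e : ∀ k, coeff j (PowerSeries.C (I.choose k : ℂ) * (-(1 + X)) ^ k)
      = (I.choose k : ℂ) * ((-1) ^ k * (k.choose j : ℂ)) := by
    intro k
    have h3 := binSeries_add_natCast 0 k
    rw [zero_add, binSeries_zero, mul_one] at h3
    have h4 : ((-1 : ℂ⟦X⟧)) ^ k = C ((-1) ^ k) := by simp
    rw [neg_pow, ← h3, h4, coeff_C_mul, coeff_C_mul, binSeries, coeff_mk, gbinom_natCast]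
  simp only [e] at h2
  have h4 : ((-1 : ℂ⟦X⟧)) ^ I = C ((-1) ^ I) := by simp
  rw [← h2, neg_pow, h4, coeff_C_mul, coeff_X_pow]
  simp [eq_comm]

open PowerSeries in
lemma sum_choose_mul_coeff_X_pow_mul {I n : ℕ} (h : I ≤ n) (e : ℂ) (j : ℕ) :
    ∑ k ∈ Finset.range (n + 1), (I.choose k : ℂ) * coeff j (X ^ k * binSeries e)
      = gbinom (e + I) j := by
  have h1 := congrArg (coeff j) (binSeries_add_natCast e I)
  rw [one_add_pow_eq_sum h, Finset.sum_mul, map_sum, binSeries, coeff_mk] at h1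
  rw [h1]
  refine Finset.sum_congr rfl fun k _ => ?_
  rw [mul_assoc, coeff_C_mul]

open PowerSeries in
lemma sum_choose_mul_skewEntry {a : ℂ} (ha : ∀ k : ℕ, 2 * a + k ≠ 0) {I n : ℕ} (h : I ≤ n)
    (hI : I ≠ 0) (j : ℕ) :
    ∑ k ∈ Finset.range (n + 1), (I.choose k : ℂ) * ((-1) ^ k * ((skewEntry a k j - 1) * (-1) ^ j))
      = ((if I = j then -1 else 0) + gbinom (2 * a + I + j - 1) j) * skewWeight a j := by
  have h1 := sum_choose_mul_choose h j
  have h2 := sum_choose_mul_choose h 0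
  have h3 := sum_choose_mul_coeff_X_pow_mul h (2 * a + j - 1) j
  rw [if_neg hI] at h2
  have key : ∀ k, (I.choose k : ℂ) * ((-1) ^ k * ((skewEntry a k j - 1) * (-1) ^ j))
      = skewWeight a j * ((I.choose k : ℂ) * coeff j (X ^ k * binSeries (2 * a + j - 1)))
        - skewWeight a j * (-1) ^ j * ((I.choose k : ℂ) * ((-1) ^ k * (k.choose j : ℂ)))
        - (-1) ^ j * ((I.choose k : ℂ) * ((-1) ^ k * (k.choose 0 : ℂ))) := by
    intro k
    have h4 : skewWeight a k * (j.choose k : ℂ) * (-1) ^ k * (-1) ^ j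
        = skewWeight a j * coeff j (X ^ k * binSeries (2 * a + j - 1)) := by
      rw [coeff_X_pow_mul']
      split_ifs with hk
      · obtain ⟨l, rfl⟩ := Nat.exists_eq_add_of_le hk
        have h7 : ((-1 : ℂ) ^ l) * (-1) ^ l = 1 := by rw [← mul_pow]; simp
        have h8 : ((-1 : ℂ) ^ k) * (-1) ^ k = 1 := by rw [← mul_pow]; simp
        rw [skewWeight_mul_choose ha hk, show -2 * a - (k : ℂ) = -(2 * a + k) by ring,
          gbinom_neg_eq, Nat.add_sub_cancel_left, binSeries, coeff_mk, pow_add]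
        push_cast
        rw [add_assoc (2 * a)]
        linear_combination skewWeight a (k + l) * gbinom (2 * a + (k + l) - 1) l
          * (h7 + (-1) ^ l * (-1) ^ l * h8)
      · rw [Nat.choose_eq_zero_of_lt (by omega)]
        simp
    rw [skewEntry, Nat.choose_zero_right, Nat.cast_one]
    linear_combination (I.choose k : ℂ) * h4
  rw [Finset.sum_congr rfl fun k _ => key k, Finset.sum_sub_distrib, Finset.sum_sub_distrib,
    ← Finset.mul_sum, ← Finset.mul_sum, ← Finset.mul_sum, h1, h2, h3,
    show 2 * a + j - 1 + (I : ℂ) = 2 * a + I + j - 1 by ring]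
  split_ifs with hj
  · subst hj
    have h8 : ((-1 : ℂ) ^ I) * (-1) ^ I = 1 := by rw [← mul_pow]; simp
    linear_combination -skewWeight a I * h8
  · ring

/-- The matrix of the determinant evaluation, in the parameter `a = (μ - 1) / 2`. -/
noncomputable def xinMatrix (a : ℂ) (n : ℕ) : Matrix (Fin n) (Fin n) ℂ :=
  of fun i j => (if i = j then -1 else 0) + gbinom (2 * a + i + j + 1) (j + 1)

lemma det_xinMatrix_mul {a : ℂ} (ha : ∀ k : ℕ, 2 * a + k ≠ 0) (n : ℕ) :
    (xinMatrix a n).det * ∏ j ∈ Finset.range n, skewWeight a (j + 1)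
      = (of fun i j : Fin n => skewEntry a (i + 1) (j + 1) - 1).det := by
  have h : xinMatrix a n * diagonal (fun j : Fin n => skewWeight a (j + 1))
      = of (fun i j : Fin n => (((i + 1 : ℕ).choose (j + 1) : ℕ) : ℂ))
        * (diagonal (fun j : Fin n => (-1) ^ (j + 1 : ℕ))
          * ((of fun i j : Fin n => skewEntry a (i + 1) (j + 1) - 1)
            * diagonal (fun j : Fin n => (-1) ^ (j + 1 : ℕ)))) := by
    ext i j
    have h1 := sum_choose_mul_skewEntry ha (I := i + 1) (n := n) (by omega) (by omega) (j + 1)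
    rw [Finset.sum_range_succ'] at h1
    have h2 : skewEntry a 0 (j + 1) = 1 := by
      rw [skewEntry_swap, skewEntry_succ_zero, neg_neg]
    rw [h2, sub_self, zero_mul, mul_zero, mul_zero, add_zero, Finset.sum_range] at h1
    rw [mul_diagonal, mul_apply]
    simp only [diagonal_mul, mul_diagonal, of_apply, xinMatrix]
    rw [h1]
    simp only [add_left_inj, Fin.val_inj]
    congr 4
    push_cast
    ring
  have hL : (of (fun i j : Fin n => (((i + 1 : ℕ).choose (j + 1) : ℕ) : ℂ))).det = 1 := by
    rw [det_of_isLowerTriangular]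
    · simp
    · intro i j hij
      have hij : i < j := hij
      rw [of_apply, Nat.choose_eq_zero_of_lt (by omega), Nat.cast_zero]
  have h2 := congrArg det h
  rw [det_mul, det_mul, det_mul, det_mul, hL, det_diagonal, det_diagonal,
    Finset.prod_range fun j => skewWeight a (j + 1)] at *
  have h3 : (∏ j : Fin n, (-1 : ℂ) ^ (j + 1 : ℕ)) * ∏ j : Fin n, (-1 : ℂ) ^ (j + 1 : ℕ) = 1 := by
    rw [← Finset.prod_mul_distrib]
    refine Finset.prod_eq_one fun j _ => ?_
    rw [← mul_pow]
    simp
  rw [h2]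
  linear_combination (of fun i j : Fin n => skewEntry a (i + 1) (j + 1) - 1).det * h3

lemma det_skewEntry_sub_one {N : ℕ} {a : ℂ} (ha : ∀ k : ℕ, 2 * a + k ≠ 0) :
    (of fun i j : Fin (2 * N) => skewEntry a (i + 1) (j + 1) - 1).det = skewDet a 1 (2 * N) := by
  have h0 : ∀ j : Fin (2 * N),
      ∑ i : Fin (2 * N), skewEntry a (j + 1) (i + 1) * kerVec N a (i + 1) = 1 := by
    intro j
    have h := sum_skewEntry_mul_kerVec_eq_zero (N := N) ha (j := j + 1) (M := 2 * N + 1)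
      (by omega) (by omega)
    rw [Finset.sum_range_succ', skewEntry_succ_zero, kerVec_zero, Finset.sum_range] at h
    linear_combination h
  have h1 : ∑ i : Fin (2 * N), kerVec N a (i + 1) = 0 := by
    have h := sum_kerVec N a
    rw [Finset.sum_range_succ', kerVec_zero, Finset.sum_range] at h
    linear_combination h
  have h2 : (of fun i j : Fin (2 * N) => skewEntry a (i + 1) (j + 1) - 1)
      = (of fun i j : Fin (2 * N) => skewEntry a (i + 1) (j + 1))
        * (1 - of (fun (i : Fin (2 * N)) (_ : Unit) => kerVec N a (i + 1))
          * of (fun (_ : Unit) (_ : Fin (2 * N)) => (1 : ℂ))) := by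
    rw [mul_sub, mul_one, ← Matrix.mul_assoc]
    ext i j
    simp [mul_apply, h0]
  rw [h2, det_mul, det_one_sub_mul_comm, skewDet]
  simp [mul_apply, h1]

end Factorization

section ProductFormula

/-- The first family of linear factors in the product formula. -/
noncomputable def prodHalf (c : ℂ) (N : ℕ) : ℂ :=
  ∏ i ∈ Finset.range (N / 2), poch (c + 3 * i + 5 / 2) (N - 1 - 2 * i)

/-- The second family of linear factors in the product formula. -/
noncomputable def prodInt (c : ℂ) (N : ℕ) : ℂ :=
  ∏ i ∈ Finset.range (N / 2), poch (c + 2 * N - i) (N - 2 - 2 * i)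

lemma poch_two_mul (x : ℂ) (k : ℕ) :
    poch (2 * x) (2 * k) = 4 ^ k * (poch x k * poch (x + 1 / 2) k) := by
  induction k with
  | zero => simp [poch_zero]
  | succ k ih =>
    rw [show 2 * (k + 1) = 2 * k + 1 + 1 by ring, poch_succ, poch_succ, ih, poch_succ, poch_succ]
    push_cast
    ring

lemma poch_two_mul_succ (x : ℂ) (N : ℕ) :
    poch (2 * x) (N + 1)
      = 2 ^ (N + 1) * (poch x (N / 2 + 1) * poch (x + 1 / 2) ((N + 1) / 2)) := by
  obtain ⟨k, rfl | rfl⟩ := Nat.even_or_odd' N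
  · rw [show 2 * k / 2 = k by omega, show (2 * k + 1) / 2 = k by omega, poch_succ, poch_two_mul,
      poch_succ, pow_succ, pow_mul]
    push_cast
    ring
  · rw [show (2 * k + 1) / 2 = k by omega, show (2 * k + 1 + 1) / 2 = k + 1 by omega,
      show 2 * k + 1 + 1 = 2 * (k + 1) by ring, poch_two_mul, pow_mul]
    norm_num

lemma prodHalf_succ (c : ℂ) (N : ℕ) :
    prodHalf c (N + 1) = prodHalf c N * poch (c + N + 3 / 2) ((N + 1) / 2) := by
  have h : prodHalf c N
      = ∏ i ∈ Finset.range ((N + 1) / 2), poch (c + 3 * i + 5 / 2) (N - 1 - 2 * i) := by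
    obtain ⟨k, rfl | rfl⟩ := Nat.even_or_odd' N
    · rw [prodHalf, show (2 * k + 1) / 2 = 2 * k / 2 by omega]
    · rw [prodHalf, show (2 * k + 1) / 2 = k by omega, show (2 * k + 1 + 1) / 2 = k + 1 by omega,
        Finset.prod_range_succ, show 2 * k + 1 - 1 - 2 * k = 0 by omega, poch_zero, mul_one]
  rw [h, prodHalf, poch, ← Finset.prod_mul_distrib]
  refine Finset.prod_congr rfl fun i hi => ?_
  have hi := Finset.mem_range.1 hi
  rw [show N + 1 - 1 - 2 * i = N - 1 - 2 * i + 1 by omega, poch_succ,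
    show N - 1 - 2 * i = N - (1 + 2 * i) by omega, Nat.cast_sub (by omega)]
  push_cast
  ring

lemma prodInt_succ (c : ℂ) (N : ℕ) :
    prodInt c (N + 1) * poch (c + N + 1) (N + 1)
      = prodInt c N * poch (c + 2 * N + 1) N * poch (c + N + 1) (N / 2 + 1) := by
  have h1 : prodInt c N * poch (c + 2 * N + 1) N
      = ∏ i ∈ Finset.range ((N + 1) / 2), poch (c + 2 * N + 1 - i) (N - 2 * i) := by
    have h : prodInt c N * poch (c + 2 * N + 1) N
        = ∏ i ∈ Finset.range (N / 2 + 1), poch (c + 2 * N + 1 - i) (N - 2 * i) := by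
      rw [Finset.prod_range_succ', prodInt]
      congr 1
      · refine Finset.prod_congr rfl fun i _ => ?_
        rw [show N - 2 * (i + 1) = N - 2 - 2 * i by omega]
        congr 1
        push_cast
        ring
      · simp
    rw [h]
    obtain ⟨k, rfl | rfl⟩ := Nat.even_or_odd' N
    · rw [show (2 * k + 1) / 2 = k by omega, show 2 * k / 2 = k by omega, Finset.prod_range_succ,
        Nat.sub_self, poch_zero, mul_one]
    · rw [show (2 * k + 1) / 2 + 1 = (2 * k + 1 + 1) / 2 by omega]
  have h2 : poch (c + N + 1 + (N / 2 + 1 : ℕ)) ((N + 1) / 2)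
      = ∏ i ∈ Finset.range ((N + 1) / 2), (c + 2 * N + 1 - i) := by
    rw [poch, ← Finset.prod_range_reflect]
    refine Finset.prod_congr rfl fun i hi => ?_
    have hi := Finset.mem_range.1 hi
    have h : (((N + 1) / 2 - 1 - i : ℕ) : ℂ) + ((N / 2 + 1 : ℕ) : ℂ) + i = N := by
      exact_mod_cast (by omega : (N + 1) / 2 - 1 - i + (N / 2 + 1) + i = N)
    linear_combination h
  have h3 : poch (c + N + 1) (N + 1)
      = poch (c + N + 1) (N / 2 + 1) * poch (c + N + 1 + (N / 2 + 1 : ℕ)) ((N + 1) / 2) := by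
    rw [← poch_add]
    congr 1
    omega
  have h4 : prodInt c (N + 1) * ∏ i ∈ Finset.range ((N + 1) / 2), (c + 2 * N + 1 - i)
      = ∏ i ∈ Finset.range ((N + 1) / 2), poch (c + 2 * N + 1 - i) (N - 2 * i) := by
    rw [prodInt, ← Finset.prod_mul_distrib]
    refine Finset.prod_congr rfl fun i hi => ?_
    have hi := Finset.mem_range.1 hi
    rw [show N - 2 * i = N + 1 - 2 - 2 * i + 1 by omega, poch_succ',
      show c + 2 * (N : ℂ) + 1 - i + 1 = c + 2 * (N + 1 : ℕ) - i by push_cast; ring]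
    ring
  rw [h1, h3, h2, ← h4]
  ring

lemma prodHalf_mul_prodInt_succ (c : ℂ) (N : ℕ) :
    2 ^ (N + 1) * (prodHalf c (N + 1) * prodInt c (N + 1)) * poch (c + N + 1) (N + 1)
      = prodHalf c N * prodInt c N * poch (c + 2 * N + 1) N * poch (2 * (c + N + 1)) (N + 1) := by
  have h1 := prodHalf_succ c N
  have h2 := prodInt_succ c N
  have h3 := poch_two_mul_succ (c + N + 1) N
  rw [show c + (N : ℂ) + 1 + 1 / 2 = c + N + 3 / 2 by ring] at h3
  rw [h1, h3]
  linear_combination 2 ^ (N + 1) * prodHalf c N * poch (c + N + 3 / 2) ((N + 1) / 2) * h2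

lemma kerCoeff_self {N : ℕ} {a : ℂ} (ha : ∀ k : ℕ, 2 * a + k ≠ 0) :
    kerCoeff N a N * ((2 * N).factorial * poch (2 * a + 2 * N + 1) N)
      = poch a N * poch (a + N + 1 / 2) N * 4 ^ N * N.factorial := by
  have h1 := prod_range_cast_sub_mul_factorial N N le_rfl
  have h2 := prod_range_cast_sub_mul_factorial (2 * N) N (by omega)
  have h3 : ∏ i ∈ Finset.range N, ((i : ℂ) + 1) = N.factorial := by
    exact_mod_cast Finset.prod_range_add_one_eq_factorial N
  have h4 : ∏ i ∈ Finset.range N, ((i : ℂ) + 1 + 2 * N + 2 * a) = poch (2 * a + 2 * N + 1) N :=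
    Finset.prod_congr rfl fun i _ => by ring
  have h5 : ∏ i ∈ Finset.range N, ((i : ℂ) + a) = poch a N :=
    Finset.prod_congr rfl fun i _ => by ring
  have h6 : ∏ i ∈ Finset.range N, (2 * (2 * (i : ℂ) + 2 * a + 2 * N + 1))
      = 4 ^ N * poch (a + N + 1 / 2) N := by
    have h : ∀ i : ℕ, 2 * (2 * (i : ℂ) + 2 * a + 2 * N + 1) = 4 * (a + N + 1 / 2 + i) :=
      fun i => by ring
    rw [Finset.prod_congr rfl fun i _ => h i, Finset.prod_mul_distrib, Finset.prod_const,
      Finset.card_range, poch]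
  have e : kerCoeff N a N = (∏ i ∈ Finset.range N, ((N : ℂ) - i))
      * (∏ i ∈ Finset.range N, ((i : ℂ) + a))
      * (∏ i ∈ Finset.range N, (2 * (2 * (i : ℂ) + 2 * a + 2 * N + 1)))
      / ((∏ i ∈ Finset.range N, ((i : ℂ) + 1))
        * (∏ i ∈ Finset.range N, ((i : ℂ) + 1 + 2 * N + 2 * a))
        * ∏ i ∈ Finset.range N, (((2 * N : ℕ) : ℂ) - i)) := by
    simp only [← Finset.prod_mul_distrib, ← Finset.prod_div_distrib, kerCoeff]
    refine Finset.prod_congr rfl fun i _ => ?_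
    push_cast
    ring
  rw [show 2 * N - N = N by omega] at h2
  rw [Nat.sub_self, Nat.factorial_zero, Nat.cast_one, mul_one] at h1
  have n1 : poch (2 * a + 2 * N + 1) N ≠ 0 := poch_ne_zero fun i _ =>
    add_natCast_ne_zero ha (2 * N + 1 + i) (by push_cast; ring)
  have n2 : (N.factorial : ℂ) ≠ 0 := by exact_mod_cast N.factorial_ne_zero
  have n3 : ∏ i ∈ Finset.range N, (((2 * N : ℕ) : ℂ) - i) ≠ 0 := by
    apply left_ne_zero_of_mul (b := (N.factorial : ℂ))
    rw [h2]
    exact_mod_cast (2 * N).factorial_ne_zero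
  rw [e, h1, h3, h4, h5, h6, ← h2]
  generalize poch (2 * a + 2 * N + 1) N = P at *
  field_simp

end ProductFormula

section Evaluation

lemma prodHalf_mul_prodInt_succ_mul_kerCoeff {N : ℕ} {a : ℂ} (ha : ∀ k : ℕ, 2 * a + k ≠ 0) :
    2 ^ (N + 1) * (N.factorial / (2 * N).factorial)
        * (prodHalf (a + 1 / 2) (N + 1) * prodInt (a + 1 / 2) (N + 1))
        * skewWeight a (2 * N + 1) * kerCoeff (N + 1) a (N + 1)
      = (-1) ^ N * (kerRes N a * (prodHalf (a + 1 / 2) N * prodInt (a + 1 / 2) N)) := by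
  have hA := prodHalf_mul_prodInt_succ (a + 1 / 2) N
  have hB := kerCoeff_self (N := N + 1) ha
  have hC := kerRes_mul (N := N) ha
  have hD := poch_two_mul a (N + 1)
  have hE : skewWeight a (2 * N + 1) * poch (2 * a) (2 * N + 1) = -(2 * N + 1).factorial := by
    rw [skewWeight, div_mul_cancel₀ _ (poch_two_mul_ne_zero ha _), pow_succ, pow_mul]
    simp
  rw [show 2 * (N + 1) = 2 * N + 1 + 1 by ring, poch_succ, poch_succ (a + 1 / 2)] at hD
  have n0 : 2 * a + ((2 * N + 1 : ℕ) : ℂ) ≠ 0 := ha _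
  have n1 : poch (2 * a) (2 * N + 1) ≠ 0 := poch_two_mul_ne_zero ha _
  have n2 : poch a (N + 1) ≠ 0 := poch_half_ne_zero ha 0 _ (by simp)
  have n3 : poch (a + 1 / 2) N ≠ 0 := poch_half_ne_zero ha 1 _ (by push_cast; ring)
  have n4 : poch (2 * a + 2 * (N + 1 : ℕ) + 1) (N + 1) ≠ 0 := poch_ne_zero fun i _ =>
    add_natCast_ne_zero ha (2 * (N + 1) + 1 + i) (by push_cast; ring)
  have n5 : (N.factorial : ℂ) ≠ 0 := by exact_mod_cast N.factorial_ne_zero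
  have n6 : ((2 * N).factorial : ℂ) ≠ 0 := by exact_mod_cast (2 * N).factorial_ne_zero
  have n7 : ((2 * N + 1).factorial : ℂ) ≠ 0 := by exact_mod_cast (2 * N + 1).factorial_ne_zero
  have n8 : (N : ℂ) + 1 ≠ 0 := by exact_mod_cast N.succ_ne_zero
  have n9 : poch (a + N + 3 / 2) (N + 1) ≠ 0 :=
    poch_half_ne_zero ha (2 * N + 3) _ (by push_cast; ring)
  rw [show 2 * (N + 1) = 2 * N + 1 + 1 by ring, Nat.factorial_succ (2 * N + 1),
    Nat.factorial_succ N] at hB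
  rw [show a + 1 / 2 + (N : ℂ) + 1 = a + N + 3 / 2 by ring,
    show a + 1 / 2 + 2 * (N : ℂ) + 1 = a + 2 * N + 3 / 2 by ring,
    show 2 * (a + (N : ℂ) + 3 / 2) = 2 * a + 2 * (N + 1 : ℕ) + 1 by push_cast; ring] at hA
  rw [show a + ((N + 1 : ℕ) : ℂ) + 1 / 2 = a + N + 3 / 2 by push_cast; ring] at hB
  have hE' : skewWeight a (2 * N + 1) * (4 ^ (N + 1) * poch a (N + 1) * poch (a + 1 / 2) N)
      = -2 * (2 * N + 1).factorial := by
    apply mul_right_cancel₀ n0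
    push_cast at hD ⊢
    linear_combination (-2 * skewWeight a (2 * N + 1)) * hD + 2 * (2 * a + (2 * N + 1)) * hE
  have hB' : kerCoeff (N + 1) a (N + 1) * (2 * (2 * N + 1).factorial
        * poch (2 * a + 2 * (N + 1 : ℕ) + 1) (N + 1))
      = poch a (N + 1) * poch (a + N + 3 / 2) (N + 1) * 4 ^ (N + 1) * N.factorial := by
    apply mul_right_cancel₀ n8
    push_cast at hB ⊢
    linear_combination hB
  have hs : ((-1 : ℂ) ^ N) * (-1) ^ N = 1 := by rw [← mul_pow]; simp
  have n10 : (4 : ℂ) ≠ 0 := by norm_num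
  have hK := eq_div_of_mul_eq (mul_ne_zero (mul_ne_zero two_ne_zero n7) n4) hB'
  have hW := eq_div_of_mul_eq (mul_ne_zero (mul_ne_zero (pow_ne_zero (N + 1) n10) n2) n3) hE'
  have hR := eq_div_of_mul_eq n6 hC
  have hR := eq_div_of_mul_eq n3 hR
  rw [hK, hW, hR]
  generalize prodHalf (a + 1 / 2) (N + 1) * prodInt (a + 1 / 2) (N + 1) = Q' at *
  generalize prodHalf (a + 1 / 2) N * prodInt (a + 1 / 2) N = Q at *
  generalize poch (2 * a + 2 * (N + 1 : ℕ) + 1) (N + 1) = P₁ at *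
  generalize poch (a + N + 3 / 2) (N + 1) = P₂ at *
  generalize poch (a + 2 * N + 3 / 2) N = P₃ at *
  generalize poch (a + 1 / 2) N = P₄ at *
  generalize poch a (N + 1) = P₅ at *
  generalize ((2 * N + 1).factorial : ℂ) = f₁ at *
  generalize ((2 * N).factorial : ℂ) = f₂ at *
  generalize (N.factorial : ℂ) = f₃ at *
  have e : (-1 : ℂ) ^ (N + 1) = -(-1) ^ N := by rw [pow_succ]; ring
  rw [e]
  trans -(f₃ ^ 2 * (2 ^ (N + 1) * Q' * P₂) / (f₂ * P₄ * P₁))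
  · field_simp
  · rw [hA]
    field_simp
    linear_combination Q * P₃ * hs

/-- The closed form of the determinant of size `2 N`, in the variable `c = μ / 2`. -/
noncomputable def xinProduct (c : ℂ) (N : ℕ) : ℂ :=
  (-1) ^ N * 2 ^ (N * (N + 1)) * poch c N / (N.factorial : ℂ)
    * (∏ i ∈ Finset.range N, ((i.factorial : ℂ) ^ 2 / ((2 * i).factorial : ℂ) ^ 2))
    * (prodHalf c N * prodInt c N) ^ 2

lemma det_xinMatrix_succ {N : ℕ} {a : ℂ} (ha : ∀ k : ℕ, 2 * a + k ≠ 0) :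
    (xinMatrix a (2 * (N + 1))).det * (skewWeight a (2 * N + 1) * skewWeight a (2 * N + 2)
        * kerCoeff (N + 1) a (N + 1) ^ 2)
      = (xinMatrix a (2 * N)).det * kerRes N a ^ 2 := by
  have h1 := skewDet_one_succ (N := N) ha
  rw [← det_skewEntry_sub_one ha, ← det_skewEntry_sub_one ha, ← det_xinMatrix_mul ha,
    ← det_xinMatrix_mul ha, show 2 * (N + 1) = 2 * N + 1 + 1 by ring, Finset.prod_range_succ,
    Finset.prod_range_succ] at h1
  have h2 : ∏ j ∈ Finset.range (2 * N), skewWeight a (j + 1) ≠ 0 :=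
    Finset.prod_ne_zero_iff.2 fun j _ => div_ne_zero
      (mul_ne_zero (by simp) (by exact_mod_cast (j + 1).factorial_ne_zero))
      (poch_two_mul_ne_zero ha _)
  apply mul_right_cancel₀ h2
  rw [show 2 * (N + 1) = 2 * N + 1 + 1 by ring]
  linear_combination h1

lemma xinProduct_succ {N : ℕ} {a : ℂ} (ha : ∀ k : ℕ, 2 * a + k ≠ 0) :
    xinProduct (a + 1 / 2) (N + 1) * (skewWeight a (2 * N + 1) * skewWeight a (2 * N + 2)
        * kerCoeff (N + 1) a (N + 1) ^ 2)
      = xinProduct (a + 1 / 2) N * kerRes N a ^ 2 := by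
  have h := prodHalf_mul_prodInt_succ_mul_kerCoeff (N := N) ha
  have h2 : skewWeight a (2 * N + 2) * (a + 1 / 2 + N) = -(N + 1) * skewWeight a (2 * N + 1) := by
    have n0 : 2 * a + ((2 * N + 1 : ℕ) : ℂ) ≠ 0 := ha _
    have n1 : poch (2 * a) (2 * N + 1) ≠ 0 := poch_two_mul_ne_zero ha _
    rw [skewWeight, skewWeight, poch_succ, Nat.factorial_succ, pow_succ _ (2 * N + 1)]
    push_cast at n0 ⊢
    field_simp
    ring
  have n1 : (N.factorial : ℂ) ≠ 0 := by exact_mod_cast N.factorial_ne_zero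
  have n2 : ((2 * N).factorial : ℂ) ≠ 0 := by exact_mod_cast (2 * N).factorial_ne_zero
  have n3 : (N : ℂ) + 1 ≠ 0 := by exact_mod_cast N.succ_ne_zero
  have hs : ((-1 : ℂ) ^ N) ^ 2 = 1 := by rw [← pow_mul, mul_comm, pow_mul]; simp
  have hsq := congrArg (fun x => x ^ 2) h
  simp only [mul_pow _ _ 2, hs, one_mul] at hsq
  have e : xinProduct (a + 1 / 2) (N + 1) * (skewWeight a (2 * N + 1) * skewWeight a (2 * N + 2)
        * kerCoeff (N + 1) a (N + 1) ^ 2)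
      = (-1) ^ N * 2 ^ (N * (N + 1)) * poch (a + 1 / 2) N / (N.factorial : ℂ)
        * (∏ i ∈ Finset.range N, ((i.factorial : ℂ) ^ 2 / ((2 * i).factorial : ℂ) ^ 2))
        * (-(skewWeight a (2 * N + 2) * (a + 1 / 2 + N)) * skewWeight a (2 * N + 1) / (N + 1)
          * ((2 ^ (N + 1)) ^ 2 * (N.factorial / (2 * N).factorial) ^ 2
            * (prodHalf (a + 1 / 2) (N + 1) ^ 2 * prodInt (a + 1 / 2) (N + 1) ^ 2)
            * kerCoeff (N + 1) a (N + 1) ^ 2)) := by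
    rw [xinProduct, Finset.prod_range_succ, poch_succ, Nat.factorial_succ,
      show (N + 1) * (N + 1 + 1) = N * (N + 1) + (N + 1) * 2 by ring, pow_add _ (N * (N + 1)),
      pow_mul _ (N + 1), pow_succ _ N]
    generalize ∏ i ∈ Finset.range N, ((i.factorial : ℂ) ^ 2 / ((2 * i).factorial : ℂ) ^ 2) = R
    generalize prodHalf (a + 1 / 2) (N + 1) = Q₁
    generalize prodInt (a + 1 / 2) (N + 1) = Q₂
    push_cast
    field_simp
  rw [e, h2]
  have h3 : -(-(N + 1 : ℂ) * skewWeight a (2 * N + 1)) * skewWeight a (2 * N + 1) / (N + 1)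
      = skewWeight a (2 * N + 1) ^ 2 := by
    field_simp
  rw [h3, xinProduct]
  linear_combination (-1) ^ N * 2 ^ (N * (N + 1)) * poch (a + 1 / 2) N / (N.factorial : ℂ)
    * (∏ i ∈ Finset.range N, ((i.factorial : ℂ) ^ 2 / ((2 * i).factorial : ℂ) ^ 2)) * hsq

lemma kerCoeff_self_ne_zero {N : ℕ} {a : ℂ} (ha : ∀ k : ℕ, 2 * a + k ≠ 0) :
    kerCoeff N a N ≠ 0 := by
  intro h
  have h1 := kerCoeff_self (N := N) ha
  have n1 : poch a N ≠ 0 := poch_half_ne_zero ha 0 _ (by simp)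
  have n2 : poch (a + N + 1 / 2) N ≠ 0 := poch_half_ne_zero ha (2 * N + 1) _ (by push_cast; ring)
  have n3 : (N.factorial : ℂ) ≠ 0 := by exact_mod_cast N.factorial_ne_zero
  rw [h, zero_mul] at h1
  exact mul_ne_zero (mul_ne_zero (mul_ne_zero n1 n2) (by simp)) n3 h1.symm

lemma det_xinMatrix {a : ℂ} (ha : ∀ k : ℕ, 2 * a + k ≠ 0) (N : ℕ) :
    (xinMatrix a (2 * N)).det = xinProduct (a + 1 / 2) N := by
  induction N with
  | zero => simp [xinProduct, prodHalf, prodInt, poch_zero]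
  | succ N ih =>
    have h1 := det_xinMatrix_succ (N := N) ha
    have h2 := xinProduct_succ (N := N) ha
    have hw : ∀ j, skewWeight a j ≠ 0 := fun j => div_ne_zero
      (mul_ne_zero (by simp) (by exact_mod_cast j.factorial_ne_zero)) (poch_two_mul_ne_zero ha _)
    rw [ih, ← h2] at h1
    exact mul_right_cancel₀ (mul_ne_zero (mul_ne_zero (hw _) (hw _))
      (pow_ne_zero 2 (kerCoeff_self_ne_zero ha))) h1

lemma continuous_gbinom (k : ℕ) : Continuous fun x : ℂ => gbinom x k := by
  unfold gbinom
  fun_prop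

lemma continuous_poch (k : ℕ) : Continuous fun x : ℂ => poch x k := by
  unfold poch
  fun_prop

lemma det_xinMatrix_eq_xinProduct (a : ℂ) (N : ℕ) :
    (xinMatrix a (2 * N)).det = xinProduct (a + 1 / 2) N := by
  have hd : Dense {a : ℂ | ∀ k : ℕ, 2 * a + k ≠ 0} := by
    have hc : (Set.range fun k : ℕ => -(k : ℂ) / 2).Countable := Set.countable_range _
    refine Dense.mono ?_ (hc.dense_compl ℝ)
    intro x hx k h
    refine hx ⟨k, ?_⟩
    linear_combination (-1 / 2 : ℂ) * h
  have h1 : Continuous fun a : ℂ => (xinMatrix a (2 * N)).det := by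
    refine Continuous.matrix_det (continuous_matrix fun i j => ?_)
    exact continuous_const.add ((continuous_gbinom _).comp (by fun_prop))
  have h2 : Continuous fun a : ℂ => xinProduct (a + 1 / 2) N := by
    have hp := fun k => continuous_poch k
    unfold xinProduct prodHalf prodInt
    fun_prop
  exact congrFun (h1.ext_on hd h2 fun a ha => det_xinMatrix ha N) a

lemma poch_neg_sq (x : ℂ) (m : ℕ) : poch (-x) m ^ 2 = poch (x - m + 1) m ^ 2 := by
  have h : poch (-x) m = (-1) ^ m * poch (x - m + 1) m := by
    have h1 := gbinom_neg (-x) m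
    have h2 := gbinom_neg (x - m + 1) m
    have h3 := gbinom_neg_eq (x - m + 1) m
    rw [h2, show x - (m : ℂ) + 1 + m - 1 = -(-x) by ring, h1] at h3
    have hm : (m.factorial : ℂ) ≠ 0 := by exact_mod_cast m.factorial_ne_zero
    have hs : (-1 : ℂ) ^ m ≠ 0 := by simp
    have h4 := mul_left_cancel₀ hs h3
    rw [← mul_div_assoc, div_left_inj' hm] at h4
    rw [h4, ← mul_assoc, ← mul_pow]
    simp
  rw [h, mul_pow, ← pow_mul, mul_comm m, pow_mul, neg_one_sq, one_pow, one_mul]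

end Evaluation

/-- Xin's determinant for even dimension (Theorem 2, even case). -/
theorem xin_determinant_even (μ : ℂ) (n : ℕ) (hn : 0 < n) (hne : Even n) :
    Matrix.det (Matrix.of fun i j : Fin n =>
      (if i = j then (-1 : ℂ) else 0)
        + gbinom (μ + ((i.1 : ℂ) + 1) + ((j.1 : ℂ) + 1) - 2) (j.1 + 1))
    = (-1) ^ (n / 2) * 2 ^ (n * (n + 2) / 4) * poch (μ / 2) (n / 2) / ((n / 2).factorial : ℂ)
        * (∏ i ∈ Finset.range ((n - 2) / 2 + 1),
            ((i.factorial : ℂ) ^ 2 / ((2 * i).factorial : ℂ) ^ 2))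
        * ∏ i ∈ Finset.Icc 1 (n / 4),
            (poch ((μ + 6 * i - 1) / 2) ((n + 2 - 4 * i) / 2)) ^ 2
              * (poch ((-μ - 3 * n + 6 * i) / 2) ((n - 4 * i) / 2)) ^ 2 := by
  obtain ⟨N, rfl⟩ := hne.two_dvd
  have h := det_xinMatrix_eq_xinProduct ((μ - 1) / 2) N
  have e1 : (Matrix.of fun i j : Fin (2 * N) => (if i = j then (-1 : ℂ) else 0)
        + gbinom (μ + ((i.1 : ℂ) + 1) + ((j.1 : ℂ) + 1) - 2) (j.1 + 1))
      = xinMatrix ((μ - 1) / 2) (2 * N) := by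
    ext i j
    simp only [xinMatrix, Matrix.of_apply]
    congr 2
    ring
  have e2 : 2 * N * (2 * N + 2) / 4 = N * (N + 1) := by
    rw [show 2 * N * (2 * N + 2) = 4 * (N * (N + 1)) by ring]
    omega
  have e3 : ∏ i ∈ Finset.Icc 1 (2 * N / 4),
        (poch ((μ + 6 * i - 1) / 2) ((2 * N + 2 - 4 * i) / 2)) ^ 2
          * (poch ((-μ - 3 * (2 * N : ℕ) + 6 * i) / 2) ((2 * N - 4 * i) / 2)) ^ 2
      = (prodHalf (μ / 2) N * prodInt (μ / 2) N) ^ 2 := by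
    rw [prodHalf, prodInt, ← Finset.prod_mul_distrib, ← Finset.prod_pow,
      ← Finset.Ico_succ_right_eq_Icc,
      Finset.prod_Ico_eq_prod_range, show Order.succ (2 * N / 4) - 1 = N / 2 by
        rw [Nat.succ_eq_succ]; omega]
    refine Finset.prod_congr rfl fun i hi => ?_
    have hi := Finset.mem_range.1 hi
    rw [mul_pow, show (2 * N + 2 - 4 * (1 + i)) / 2 = N - 1 - 2 * i by omega,
      show (2 * N - 4 * (1 + i)) / 2 = N - 2 - 2 * i by omega,
      show (-μ - 3 * ((2 * N : ℕ) : ℂ) + 6 * ((1 + i : ℕ) : ℂ)) / 2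
        = -(μ / 2 + 3 * N - 3 * i - 3) by push_cast; ring, poch_neg_sq,
      show N - 2 - 2 * i = N - (2 + 2 * i) by omega, Nat.cast_sub (by omega)]
    congr 3
    · push_cast
      ring
    · push_cast
      ring
  rw [e1, e2, e3, h, xinProduct, show 2 * N / 2 = N by omega,
    show (2 * N - 2) / 2 + 1 = N by omega, show (μ - 1) / 2 + 1 / 2 = μ / 2 by ring]
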